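/- arXiv:math/0701940 — 4 statements merged into one kernel-verified Lean document; each statement's English description precedes it below -/
import Mathlib

section
/- Let (B,W) be a coloring of the plane and let a, b, c > 0. If the coloring contains an (a,b,c)-triangle, then it contains an (x,x,x)-triangle for some x ∈ {a, b, c}. -/
/-- A set of three points is monochromatic for the coloring `(B, Bᶜ)`:
all three points are black (in `B`) or all three are white (in `Bᶜ`). -/
def Mono (B : Set (EuclideanSpace ℝ (Fin 2))) (X Y Z : EuclideanSpace ℝ (Fin 2)) : Prop :=
  (X ∈ B ∧ Y ∈ B ∧ Z ∈ B) ∨ (X ∉ B ∧ Y ∉ B ∧ Z ∉ B)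

/-- The coloring `(B, Bᶜ)` contains an `(a,b,c)`-triangle. -/
def ContainsTriangle (B : Set (EuclideanSpace ℝ (Fin 2))) (a b c : ℝ) : Prop :=
  ∃ X Y Z : EuclideanSpace ℝ (Fin 2),
    Mono B X Y Z ∧ dist X Y = a ∧ dist Y Z = b ∧ dist Z X = c

/-- The plane has a linear rotation by `π / 3`. -/
theorem exists_rotation_sixty :
    ∃ J : EuclideanSpace ℝ (Fin 2) →ₗ[ℝ] EuclideanSpace ℝ (Fin 2),
      (∀ v, ‖J v‖ = ‖v‖) ∧ ∀ v, ‖v - J v‖ = ‖v‖ := by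
  have h3 : √3 * √3 = (3 : ℝ) := Real.mul_self_sqrt (by norm_num)
  refine ⟨Matrix.toLpLin 2 2 !![1 / 2, -(√3 / 2); √3 / 2, 1 / 2], fun v => ?_, fun v => ?_⟩ <;>
  · rw [EuclideanSpace.norm_eq, EuclideanSpace.norm_eq]
    congr 1
    simp only [Fin.sum_univ_two, Real.norm_eq_abs, sq_abs, PiLp.sub_apply, Matrix.toLpLin_apply,
      Matrix.mulVec, dotProduct, Matrix.of_apply, Matrix.cons_val_zero, Matrix.cons_val_one]
    linear_combination ((v 0 ^ 2 + v 1 ^ 2) / 4) * h3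

theorem stmt1 (B : Set (EuclideanSpace ℝ (Fin 2))) (a b c : ℝ)
    (ha : 0 < a) (hb : 0 < b) (hc : 0 < c)
    (h : ContainsTriangle B a b c) :
    ∃ x ∈ ({a, b, c} : Set ℝ), ContainsTriangle B x x x := by
  obtain ⟨J, hJ, hJ'⟩ := exists_rotation_sixty
  obtain ⟨X, Y, Z, hm, hXY, hYZ, hZX⟩ := h
  by_contra! hno
  have key : ∀ x ∈ ({a, b, c} : Set ℝ), ∀ P Q R d : EuclideanSpace ℝ (Fin 2),
      ‖d‖ = x → Q = P + d → R = P + J d → ¬ Mono B P Q R := by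
    rintro x hx P Q R d hd rfl rfl hmono
    refine hno x hx ⟨_, _, _, hmono, ?_, ?_, ?_⟩
    · simp [hd]
    · simp [dist_eq_norm, hJ', hd]
    · simp [hJ, hd]
  have hu : ‖Y - X‖ = a := by rw [← dist_eq_norm, dist_comm, hXY]
  have hv : ‖Z - X‖ = c := by rw [← dist_eq_norm, hZX]
  have hw : ‖Z - Y‖ = b := by rw [← dist_eq_norm, dist_comm, hYZ]
  have hu' : ‖X - Y‖ = a := by rw [← dist_eq_norm, hXY]
  have hv' : ‖X - Z‖ = c := by rw [← dist_eq_norm, dist_comm, hZX]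
  have hw' : ‖Y - Z‖ = b := by rw [← dist_eq_norm, hYZ]
  have h₁ := key a (by simp) Y X (Y - J (Y - X)) (X - Y) hu' (by abel)
    (by simp only [map_sub]; abel)
  have h₂ := key c (by simp) Z X (Z - J (Z - X)) (X - Z) hv' (by abel)
    (by simp only [map_sub]; abel)
  have h₃ := key b (by simp) Y Z (Y + J (Z - Y)) (Z - Y) hw (by abel) rfl
  have h₄ := key c (by simp) (Y - J (Y - X)) (Y - J (Y - X) + (Z - X)) (Y + J (Z - Y))
    (Z - X) hv rfl (by simp only [map_sub]; abel)
  have h₅ := key a (by simp) (Z - J (Y - X)) (Y - J (Y - X) + (Z - X)) Z (Y - X) hu (by abel)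
    (by abel)
  have h₆ := key b (by simp) (Z - J (Y - X)) (Y - J (Y - X)) (Z - J (Z - X)) (Y - Z) hw'
    (by abel) (by simp only [map_sub]; abel)
  unfold Mono at hm h₁ h₂ h₃ h₄ h₅ h₆
  clear key hno hJ hJ' hXY hYZ hZX hu hv hw hu' hv' hw'
  grind
end

section
/- A coloring (B,W) of the plane contains an (a,b,c)-triangle for every a, b, c > 0 satisfying the (possibly degenerate) triangle inequality if and only if it contains an (a,a,a)-triangle for every a > 0. -/
/-- A triangle with side lengths `1`, `b / a`, `c / a` can be placed in `ℂ` on the base `[0, 1]`. -/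
lemma exists_complex_norm_eq_div {a b c : ℝ} (ha : 0 < a) (hb : 0 < b) (hc : 0 < c)
    (h₁ : a ≤ b + c) (h₂ : b ≤ a + c) (h₃ : c ≤ a + b) :
    ∃ z : ℂ, ‖z‖ = b / a ∧ ‖1 - z‖ = c / a := by
  have hheron : 0 ≤ (b / a) ^ 2 - ((a ^ 2 + b ^ 2 - c ^ 2) / (2 * a ^ 2)) ^ 2 := by
    have h : (b / a) ^ 2 - ((a ^ 2 + b ^ 2 - c ^ 2) / (2 * a ^ 2)) ^ 2 =
        ((a + b - c) * (a + b + c)) * ((c + a - b) * (b + c - a)) / (2 * a ^ 2) ^ 2 := by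
      field_simp
      ring
    rw [h]
    have := sub_nonneg.2 h₁
    have h₂' : 0 ≤ c + a - b := by linarith
    have := sub_nonneg.2 h₃
    positivity
  refine ⟨⟨(a ^ 2 + b ^ 2 - c ^ 2) / (2 * a ^ 2), √((b / a) ^ 2 -
    ((a ^ 2 + b ^ 2 - c ^ 2) / (2 * a ^ 2)) ^ 2)⟩, ?_, ?_⟩ <;>
  · rw [← sq_eq_sq₀ (norm_nonneg _) (by positivity), Complex.sq_norm, Complex.normSq_apply]
    simp only [Complex.sub_re, Complex.sub_im, Complex.one_re, Complex.one_im, zero_sub,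
      neg_mul_neg, Real.mul_self_sqrt hheron]
    field_simp
    ring

/-- For `a`, `b`, `c` satisfying the triangle inequality, some linear similarity `M` of the plane
turns each vector `w` of length `a` into a triangle `0, w, M w` with side lengths `a`, `b`, `c`. -/
lemma exists_linearMap_norm_eq {a b c : ℝ} (ha : 0 < a) (hb : 0 < b) (hc : 0 < c)
    (h₁ : a ≤ b + c) (h₂ : b ≤ a + c) (h₃ : c ≤ a + b) :
    ∃ M : EuclideanSpace ℝ (Fin 2) →ₗ[ℝ] EuclideanSpace ℝ (Fin 2),
      ∀ w, ‖w‖ = a → ‖M w‖ = b ∧ ‖w - M w‖ = c := by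
  obtain ⟨z, hz, hz'⟩ := exists_complex_norm_eq_div ha hb hc h₁ h₂ h₃
  let e := Complex.orthonormalBasisOneI.repr
  refine ⟨e.toLinearMap ∘ₗ LinearMap.mulLeft ℝ z ∘ₗ e.symm.toLinearMap, fun w hw => ?_⟩
  have hM : (e.toLinearMap ∘ₗ LinearMap.mulLeft ℝ z ∘ₗ e.symm.toLinearMap) w =
      e (z * e.symm w) := rfl
  have hsub : w - e (z * e.symm w) = e ((1 - z) * e.symm w) := by
    rw [sub_mul, one_mul, map_sub, e.apply_symm_apply]
  rw [hM, hsub, e.norm_map, e.norm_map, norm_mul, norm_mul, e.symm.norm_map, hz, hz', hw]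
  exact ⟨div_mul_cancel₀ b ha.ne', div_mul_cancel₀ c ha.ne'⟩

/-- A coloring with a monochromatic equilateral triangle of side `a` contains every triangle
having `a` as a side length. -/
lemma ContainsTriangle.of_equilateral {B : Set (EuclideanSpace ℝ (Fin 2))} {a b c : ℝ}
    (h : ContainsTriangle B a a a) (ha : 0 < a) (hb : 0 < b) (hc : 0 < c)
    (h₁ : a ≤ b + c) (h₂ : b ≤ a + c) (h₃ : c ≤ a + b) : ContainsTriangle B a b c := by
  obtain ⟨M, hM⟩ := exists_linearMap_norm_eq ha hb hc h₁ h₂ h₃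
  obtain ⟨X, Y, Z, hmono, hXY, hYZ, hZX⟩ := h
  by_contra hno
  have key : ∀ p q r w, ‖w‖ = a → q = p + w → r = p + M w → ¬ Mono B q p r := by
    rintro p _ _ w hw rfl rfl hm
    refine hno ⟨_, _, _, hm, ?_, ?_, ?_⟩
    · rw [dist_eq_norm, add_sub_cancel_left, hw]
    · rw [dist_eq_norm, sub_add_cancel_left, norm_neg, (hM w hw).1]
    · rw [dist_comm, dist_eq_norm, add_sub_add_left_eq_sub, (hM w hw).2]
  have hu : ‖Y - X‖ = a := by rw [← dist_eq_norm, dist_comm, hXY]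
  have hu' : ‖X - Y‖ = a := by rw [← dist_eq_norm, hXY]
  have hU : ‖Z - X‖ = a := by rw [← dist_eq_norm, hZX]
  have hU' : ‖X - Z‖ = a := by rw [← dist_eq_norm, dist_comm, hZX]
  have hd : ‖Z - Y‖ = a := by rw [← dist_eq_norm, dist_comm, hYZ]
  have hd' : ‖Y - Z‖ = a := by rw [← dist_eq_norm, hYZ]
  have k₁ := key X Y (X + M (Y - X)) (Y - X) hu (by abel) rfl
  have k₂ := key X Z (X + M (Z - X)) (Z - X) hU (by abel) rfl
  have k₃ := key Y Z (Y + M (Z - Y)) (Z - Y) hd (by abel) rfl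
  have k₄ := key (Y + M (Z - X)) (X + M (Z - X)) (Y + M (Z - Y)) (X - Y) hu' (by abel)
    (by simp only [map_sub]; abel)
  have k₅ := key (X + M (Z - X)) (X + Y - Z + M (Z - X)) (X + M (Y - X)) (Y - Z) hd' (by abel)
    (by simp only [map_sub]; abel)
  have k₆ := key (Y + M (Z - X)) (X + Y - Z + M (Z - X)) Y (X - Z) hU' (by abel)
    (by simp only [map_sub]; abel)
  simp only [Mono] at hmono k₁ k₂ k₃ k₄ k₅ k₆
  clear * - hmono k₁ k₂ k₃ k₄ k₅ k₆
  grind only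

theorem stmt2 (B : Set (EuclideanSpace ℝ (Fin 2))) :
    (∀ a b c : ℝ, 0 < a → 0 < b → 0 < c → a ≤ b + c → b ≤ a + c → c ≤ a + b →
      ContainsTriangle B a b c) ↔
    (∀ a : ℝ, 0 < a → ContainsTriangle B a a a) := by
  refine ⟨fun h a ha => ?_, fun h a b c ha hb hc h₁ h₂ h₃ => ?_⟩
  · have haa : a ≤ a + a := by linarith
    exact h a a a ha ha ha haa haa haa
  · exact (h a ha).of_equilateral ha hb hc h₁ h₂ h₃
end

section
/- Let (B,W) be a coloring of the plane and let a, b, c > 0. The coloring contains a positively oriented (a,b,c)-triangle if and only if it contains a positively oriented (b,a,c)-triangle. -/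
/-- The coloring `(B, Bᶜ)` contains a positively oriented `(a,b,c)`-triangle:
there are monochromatic `X, Y, Z` with the prescribed distances and
`det (Y - X, Z - X) ≥ 0`. -/
def ContainsOrientedTriangle (B : Set (EuclideanSpace ℝ (Fin 2))) (a b c : ℝ) : Prop :=
  ∃ X Y Z : EuclideanSpace ℝ (Fin 2),
    Mono B X Y Z ∧ dist X Y = a ∧ dist Y Z = b ∧ dist Z X = c ∧
    0 ≤ (Y 0 - X 0) * (Z 1 - X 1) - (Y 1 - X 1) * (Z 0 - X 0)

namespace PlaneColoring

/-- Three complex points are monochromatic for the coloring `(S, Sᶜ)`. -/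
def MonoC (S : Set ℂ) (x y z : ℂ) : Prop :=
  (x ∈ S ∧ y ∈ S ∧ z ∈ S) ∨ (x ∉ S ∧ y ∉ S ∧ z ∉ S)

/-- The vectors `u` and `v` span, from the origin, a positively oriented `(a,b,c)`-triangle. -/
def IsShape (a b c : ℝ) (u v : ℂ) : Prop :=
  ‖u‖ = a ∧ ‖u - v‖ = b ∧ ‖v‖ = c ∧ 0 ≤ u.re * v.im - u.im * v.re

/-- The coloring `(S, Sᶜ)` of `ℂ` contains a positively oriented `(a,b,c)`-triangle. -/
def HasTriangle (S : Set ℂ) (a b c : ℝ) : Prop :=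
  ∃ x u v : ℂ, IsShape a b c u v ∧ MonoC S x (x + u) (x + v)

/-- The primitive sixth root of unity in the upper half-plane. -/
noncomputable def omega : ℂ := ⟨1 / 2, √3 / 2⟩

/-- The coloring `(S, Sᶜ)` contains an equilateral triangle of side `d`. -/
def HasEquilateral (S : Set ℂ) (d : ℝ) : Prop :=
  ∃ x δ : ℂ, ‖δ‖ = d ∧ MonoC S x (x + δ) (x + omega * δ)

lemma omega_sq : omega ^ 2 = omega - 1 := by
  have h : √3 * √3 = (3 : ℝ) := Real.mul_self_sqrt (by norm_num)
  apply Complex.ext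
  · simp [omega, pow_two]; linarith
  · simp [omega, pow_two]; ring

lemma norm_omega : ‖omega‖ = 1 := by
  have h : √3 * √3 = (3 : ℝ) := Real.mul_self_sqrt (by norm_num)
  rw [Complex.norm_eq_sqrt_sq_add_sq, Real.sqrt_eq_one]
  simp only [omega]
  linarith

lemma norm_omega_sub_one : ‖omega - 1‖ = 1 := by
  rw [← omega_sq, norm_pow, norm_omega, one_pow]

lemma norm_one_sub_omega : ‖1 - omega‖ = 1 := by
  rw [norm_sub_rev, norm_omega_sub_one]

lemma IsShape.rotate {a b c : ℝ} {u v e : ℂ} (h : IsShape a b c u v) (he : ‖e‖ = 1) :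
    IsShape a b c (e * u) (e * v) := by
  obtain ⟨h1, h2, h3, h4⟩ := h
  refine ⟨by rw [norm_mul, he, one_mul, h1], by rw [← mul_sub, norm_mul, he, one_mul, h2],
    by rw [norm_mul, he, one_mul, h3], ?_⟩
  have hn : e.re * e.re + e.im * e.im = 1 := by
    rw [← Complex.normSq_apply, Complex.normSq_eq_norm_sq, he, one_pow]
  have : (e * u).re * (e * v).im - (e * u).im * (e * v).re
      = (e.re * e.re + e.im * e.im) * (u.re * v.im - u.im * v.re) := by
    simp only [Complex.mul_re, Complex.mul_im]; ring
  rw [this, hn, one_mul]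
  exact h4

lemma IsShape.cycle {a b c : ℝ} {u v : ℂ} (h : IsShape a b c u v) :
    IsShape b c a (v - u) (-u) := by
  obtain ⟨h1, h2, h3, h4⟩ := h
  refine ⟨by rw [norm_sub_rev, h2], by simpa using h3, by rw [norm_neg, h1], ?_⟩
  simp only [Complex.sub_re, Complex.sub_im, Complex.neg_re, Complex.neg_im]
  linarith

lemma IsShape.mirror {a b c : ℝ} {u v : ℂ} (h : IsShape a b c u v) :
    IsShape b a c ((starRingEnd ℂ) (u - v)) ((starRingEnd ℂ) (-v)) := by
  obtain ⟨h1, h2, h3, h4⟩ := h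
  refine ⟨by rw [Complex.norm_conj, h2],
    by rw [← map_sub, Complex.norm_conj, sub_neg_eq_add, sub_add_cancel, h1],
    by rw [Complex.norm_conj, norm_neg, h3], ?_⟩
  simp only [Complex.sub_re, Complex.sub_im, Complex.neg_re, Complex.neg_im, Complex.conj_re,
    Complex.conj_im]
  linarith

lemma HasTriangle.cycle {S : Set ℂ} {a b c : ℝ} (h : HasTriangle S a b c) :
    HasTriangle S b c a := by
  obtain ⟨x, u, v, hs, hm⟩ := h
  refine ⟨x + u, v - u, -u, hs.cycle, ?_⟩
  rw [show x + u + (v - u) = x + v by ring, show x + u + -u = x by ring]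
  unfold MonoC at *
  tauto

lemma HasEquilateral.of_mono {S : Set ℂ} {d : ℝ} {p q r : ℂ} (hm : MonoC S p q r)
    (hd : ‖q - p‖ = d) (hr : r - p = omega * (q - p)) : HasEquilateral S d := by
  refine ⟨p, q - p, hd, ?_⟩
  rwa [← hr, add_sub_cancel, add_sub_cancel]

lemma HasTriangle.exists_equilateral {S : Set ℂ} {a b c : ℝ} (h : HasTriangle S a b c) :
    HasEquilateral S a ∨ HasEquilateral S b ∨ HasEquilateral S c := by
  obtain ⟨x, u, v, ⟨ha, hb, hc, -⟩, hm⟩ := h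
  by_contra! hne
  obtain ⟨na, nb, nc⟩ := hne
  have hw := omega_sq
  have t1 : ¬ MonoC S (x + u) (x + u + omega * v) (x + u - v + omega * v) := fun hm =>
    nc (.of_mono hm (by rw [add_sub_cancel_left, norm_mul, norm_omega, one_mul, hc])
      (by linear_combination -v * hw))
  have t2 : ¬ MonoC S x (x + v) (x + omega * v) := fun hm =>
    nc (.of_mono hm (by rw [add_sub_cancel_left, hc]) (by ring))
  have t3 : ¬ MonoC S (x + v) (x + u - omega * u + omega * v) (x + u) := fun hm =>
    nb (.of_mono hm
      (by rw [show x + u - omega * u + omega * v - (x + v) = (1 - omega) * (u - v) by ring,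
            norm_mul, norm_one_sub_omega, one_mul, hb])
      (by linear_combination (u - v) * hw))
  have t4 : ¬ MonoC S (x + omega * v) (x + u - omega * u + omega * v) (x + u + omega * v) :=
    fun hm => na (.of_mono hm
      (by rw [show x + u - omega * u + omega * v - (x + omega * v) = (1 - omega) * u by ring,
            norm_mul, norm_one_sub_omega, one_mul, ha])
      (by linear_combination u * hw))
  have t5 : ¬ MonoC S x (x + u) (x + omega * u) := fun hm =>
    na (.of_mono hm (by rw [add_sub_cancel_left, ha]) (by ring))
  have t6 : ¬ MonoC S (x + omega * v) (x + u - v + omega * v) (x + omega * u) := fun hm =>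
    nb (.of_mono hm
      (by rw [show x + u - v + omega * v - (x + omega * v) = u - v by ring, hb]) (by ring))
  simp only [MonoC] at hm t1 t2 t3 t4 t5 t6
  grind only

lemma HasTriangle.of_mono {S : Set ℂ} {a b c : ℝ} {u v p q r : ℂ} (hs : IsShape a b c u v)
    (e : ℂ) (he : ‖e‖ = 1) (hm : MonoC S p q r) (hq : q = p + e * u) (hr : r = p + e * v) :
    HasTriangle S a b c :=
  ⟨p, e * u, e * v, hs.rotate he, by rwa [← hq, ← hr]⟩

lemma IsShape.hasTriangle_of_mono {S : Set ℂ} {a b c : ℝ} {x u v : ℂ} (hs : IsShape a b c u v)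
    (hm : MonoC S x (x + u) (x + omega * u)) : HasTriangle S a b c := by
  by_contra hn
  have hw := omega_sq
  have t1 : ¬ MonoC S (x + u + omega * v) (x + omega * v) (x + u - v + omega * v) := fun hm =>
    hn (.of_mono hs (-1) (by simp) hm (by ring) (by ring))
  have t2 : ¬ MonoC S (x + u + omega * v) (x + u - omega * u + omega * v) (x + u) := fun hm =>
    hn (.of_mono hs (-omega) (by rw [norm_neg, norm_omega]) hm (by ring) (by ring))
  have t3 : ¬ MonoC S (x + omega * v) (x + u - omega * u + omega * v) (x + v) := fun hm =>
    hn (.of_mono hs (1 - omega) norm_one_sub_omega hm (by ring) (by ring))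
  have t4 : ¬ MonoC S x (x + u) (x + v) := fun hm =>
    hn (.of_mono hs 1 (by simp) hm (by ring) (by ring))
  have t5 : ¬ MonoC S x (x + omega * u) (x + omega * v) := fun hm =>
    hn (.of_mono hs omega norm_omega hm (by ring) (by ring))
  have t6 : ¬ MonoC S (x + u) (x + omega * u) (x + u - v + omega * v) := fun hm =>
    hn (.of_mono hs (omega - 1) norm_omega_sub_one hm (by ring) (by ring))
  simp only [MonoC] at hm t1 t2 t3 t4 t5 t6
  grind only

lemma HasEquilateral.hasTriangle {S : Set ℂ} {a b c : ℝ} {u v : ℂ} (ha : 0 < a)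
    (hs : IsShape a b c u v) (h : HasEquilateral S a) : HasTriangle S a b c := by
  obtain ⟨x, δ, hδ, hm⟩ := h
  have hu : u ≠ 0 := norm_pos_iff.mp (hs.1 ▸ ha)
  have hs' := hs.rotate (e := δ / u) (by rw [norm_div, hδ, hs.1, div_self ha.ne'])
  rw [div_mul_cancel₀ δ hu] at hs'
  exact hs'.hasTriangle_of_mono hm

lemma HasTriangle.mirror {S : Set ℂ} {a b c : ℝ} (ha : 0 < a) (hb : 0 < b) (hc : 0 < c)
    (h : HasTriangle S a b c) : HasTriangle S b a c := by
  obtain ⟨-, u, v, hs, -⟩ := id h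
  have hs' := hs.mirror
  rcases h.exists_equilateral with h | h | h
  · exact (h.hasTriangle ha hs'.cycle).cycle.cycle
  · exact h.hasTriangle hb hs'
  · exact (h.hasTriangle hc hs'.cycle.cycle).cycle

lemma containsOrientedTriangle_iff (B : Set (EuclideanSpace ℝ (Fin 2))) (a b c : ℝ) :
    ContainsOrientedTriangle B a b c ↔ HasTriangle {z : ℂ | !₂[z.re, z.im] ∈ B} a b c := by
  constructor
  · rintro ⟨X, Y, Z, hm, h1, h2, h3, h4⟩
    have eta (P : EuclideanSpace ℝ (Fin 2)) : !₂[P 0, P 1] = P := by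
      ext i; fin_cases i <;> rfl
    refine ⟨⟨X 0, X 1⟩, ⟨Y 0 - X 0, Y 1 - X 1⟩, ⟨Z 0 - X 0, Z 1 - X 1⟩, ⟨?_, ?_, ?_, h4⟩, ?_⟩
    · rw [← h1, dist_comm, EuclideanSpace.dist_eq, Complex.norm_eq_sqrt_sq_add_sq]
      simp [Real.dist_eq]
    · rw [← h2, EuclideanSpace.dist_eq, Complex.norm_eq_sqrt_sq_add_sq]
      simp [Real.dist_eq]
    · rw [← h3, EuclideanSpace.dist_eq, Complex.norm_eq_sqrt_sq_add_sq]
      simp [Real.dist_eq]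
    · simpa [MonoC, Mono, eta] using hm
  · rintro ⟨x, u, v, ⟨h1, h2, h3, h4⟩, hm⟩
    refine ⟨!₂[x.re, x.im], !₂[(x + u).re, (x + u).im], !₂[(x + v).re, (x + v).im], hm,
      ?_, ?_, ?_, ?_⟩
    · rw [← h1, dist_comm, EuclideanSpace.dist_eq, Complex.norm_eq_sqrt_sq_add_sq]
      simp [Real.dist_eq]
    · rw [← h2, EuclideanSpace.dist_eq, Complex.norm_eq_sqrt_sq_add_sq]
      simp [Real.dist_eq]
    · rw [← h3, EuclideanSpace.dist_eq, Complex.norm_eq_sqrt_sq_add_sq]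
      simp [Real.dist_eq]
    · simpa using h4

end PlaneColoring

theorem stmt4 (B : Set (EuclideanSpace ℝ (Fin 2))) (a b c : ℝ)
    (ha : 0 < a) (hb : 0 < b) (hc : 0 < c) :
    ContainsOrientedTriangle B a b c ↔ ContainsOrientedTriangle B b a c := by
  rw [PlaneColoring.containsOrientedTriangle_iff, PlaneColoring.containsOrientedTriangle_iff]
  exact ⟨.mirror ha hb hc, .mirror hb ha hc⟩
end

section
/- Let (B,W) be a polygonal coloring of the plane with boundary ∂, and let a, b, c > 0 satisfy the (possibly degenerate) triangle inequality with ¬(a = b = c). Then there exist points X, Y, Z, none of which lies on ∂, all in B or all in W, with dist(X,Y) = a, dist(Y,Z) = b, dist(Z,X) = c. -/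
open scoped RealInnerProductSpace

noncomputable section

/-- `l` is an (affine) line in the plane: a nonempty one-dimensional affine subspace. -/
def IsLine (l : AffineSubspace ℝ (EuclideanSpace ℝ (Fin 2))) : Prop :=
  (l : Set (EuclideanSpace ℝ (Fin 2))).Nonempty ∧ Module.finrank ℝ l.direction = 1

/-- A boundary segment: a closed convex subset of some affine line, containing
more than one point (it may be a segment, a ray, or a full line). -/
def IsSeg (s : Set (EuclideanSpace ℝ (Fin 2))) : Prop :=
  IsClosed s ∧ Convex ℝ s ∧ s.Nontrivial ∧
    ∃ l : AffineSubspace ℝ (EuclideanSpace ℝ (Fin 2)), IsLine l ∧ s ⊆ (l : Set _)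

/-- `x` is an endpoint of the segment `s`: a point of `s` not in its relative
(intrinsic) interior. -/
def IsEndpoint (x : EuclideanSpace ℝ (Fin 2)) (s : Set (EuclideanSpace ℝ (Fin 2))) : Prop :=
  x ∈ s ∧ x ∉ intrinsicInterior ℝ s

/-- The coloring `(B, Bᶜ)` is polygonal, with set of boundary segments `S`. -/
structure IsPolygonal (B : Set (EuclideanSpace ℝ (Fin 2)))
    (S : Set (Set (EuclideanSpace ℝ (Fin 2)))) : Prop where
  /-- The black points lie in the closure of the black interior. -/
  black_sub : B ⊆ closure (interior B)
  /-- The white points lie in the closure of the white interior. -/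
  white_sub : Bᶜ ⊆ closure (interior Bᶜ)
  /-- Every member of `S` is a boundary segment. -/
  seg : ∀ s ∈ S, IsSeg s
  /-- The boundary of the coloring is the union of the boundary segments. -/
  boundary : frontier B = ⋃₀ S
  /-- Two distinct boundary segments meet in at most one point. -/
  inter_subsingleton : ∀ s ∈ S, ∀ t ∈ S, s ≠ t → (s ∩ t).Subsingleton
  /-- A common point of two distinct boundary segments is an endpoint of both. -/
  inter_endpoint : ∀ s ∈ S, ∀ t ∈ S, s ≠ t → ∀ x ∈ s ∩ t, IsEndpoint x s ∧ IsEndpoint x t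
  /-- No two distinct boundary segments sharing a common point lie on a common line. -/
  no_common_line : ∀ s ∈ S, ∀ t ∈ S, s ≠ t → (s ∩ t).Nonempty →
      ¬∃ l : AffineSubspace ℝ (EuclideanSpace ℝ (Fin 2)),
        IsLine l ∧ s ⊆ (l : Set _) ∧ t ⊆ (l : Set _)
  /-- Every bounded region meets only finitely many boundary segments. -/
  loc_finite : ∀ R : Set (EuclideanSpace ℝ (Fin 2)), Bornology.IsBounded R →
      {s ∈ S | (s ∩ R).Nonempty}.Finite

/-- Condition (C3): every monochromatic unit triangle has a vertex on the boundary. -/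
def C3 (B : Set (EuclideanSpace ℝ (Fin 2))) : Prop :=
  ∀ X Y Z : EuclideanSpace ℝ (Fin 2),
    dist X Y = 1 → dist Y Z = 1 → dist Z X = 1 →
    ((X ∈ B ∧ Y ∈ B ∧ Z ∈ B) ∨ (X ∉ B ∧ Y ∉ B ∧ Z ∉ B)) →
    X ∈ frontier B ∨ Y ∈ frontier B ∨ Z ∈ frontier B

/-- `x` is a boundary vertex: an endpoint of some boundary segment. -/
def IsVertex (S : Set (Set (EuclideanSpace ℝ (Fin 2)))) (x : EuclideanSpace ℝ (Fin 2)) : Prop :=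
  ∃ s ∈ S, IsEndpoint x s

/-- A boundary point `A` is feasible if it is not a boundary vertex and the unit
circle centered at `A` contains no boundary vertex. -/
def Feasible (B : Set (EuclideanSpace ℝ (Fin 2))) (S : Set (Set (EuclideanSpace ℝ (Fin 2))))
    (A : EuclideanSpace ℝ (Fin 2)) : Prop :=
  A ∈ frontier B ∧ ¬IsVertex S A ∧ ∀ P ∈ Metric.sphere A 1, ¬IsVertex S P

/-- Two segments are parallel: any lines containing them have the same direction. -/
def SegParallel (s t : Set (EuclideanSpace ℝ (Fin 2))) : Prop :=
  ∀ l₁ l₂ : AffineSubspace ℝ (EuclideanSpace ℝ (Fin 2)),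
    IsLine l₁ → IsLine l₂ → s ⊆ (l₁ : Set _) → t ⊆ (l₂ : Set _) →
    l₁.direction = l₂.direction

end

noncomputable section

namespace PlaneColoring

open Set Metric

/-- The Euclidean scalar product on `ℂ`. -/
def dot (x y : ℂ) : ℝ := x.re * y.re + x.im * y.im

/-- The primitive sixth root of unity, that is, rotation by `60` degrees. -/
def om : ℂ := ⟨1 / 2, √3 / 2⟩

theorem sqrt_three_sq : √3 * √3 = 3 := Real.mul_self_sqrt (by norm_num)

theorem om_mul_om : om * om = om - 1 := by
  have h := sqrt_three_sq
  apply Complex.ext <;> simp [om] <;> nlinarith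

theorem norm_om : ‖om‖ = 1 := by
  have h := sqrt_three_sq
  have h2 : ‖om‖ ^ 2 = 1 := by
    rw [Complex.sq_norm, Complex.normSq_apply]; simp only [om]; nlinarith
  nlinarith [norm_nonneg om]

theorem norm_om_mul (v : ℂ) : ‖om * v‖ = ‖v‖ := by rw [norm_mul, norm_om, one_mul]

theorem norm_one_sub_om_mul (v : ℂ) : ‖(1 - om) * v‖ = ‖v‖ := by
  have h : om * ((1 - om) * v) = v := by linear_combination -v * om_mul_om
  rw [← norm_om_mul, h]

theorem dot_comm (x y : ℂ) : dot x y = dot y x := by simp only [dot]; ring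

theorem dot_add (x y z : ℂ) : dot x (y + z) = dot x y + dot x z := by simp [dot]; ring

theorem dot_sub (x y z : ℂ) : dot x (y - z) = dot x y - dot x z := by simp [dot]; ring

theorem dot_neg (x y : ℂ) : dot x (-y) = -dot x y := by simp [dot]; ring

theorem dot_smul (x : ℂ) (t : ℝ) (y : ℂ) : dot x (t • y) = t * dot x y := by
  simp [dot]; ring

theorem dot_self (x : ℂ) : dot x x = ‖x‖ ^ 2 := by
  rw [Complex.sq_norm, Complex.normSq_apply, dot]

theorem dot_self_pos {x : ℂ} (hx : x ≠ 0) : 0 < dot x x := by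
  rw [dot_self]; have := norm_pos_iff.2 hx; positivity

theorem norm_sub_sq' (x y : ℂ) : ‖x - y‖ ^ 2 = ‖x‖ ^ 2 - 2 * dot x y + ‖y‖ ^ 2 := by
  simp only [← dot_self, dot, Complex.sub_re, Complex.sub_im]; ring

theorem dot_om_add (d v : ℂ) : dot d (om * v) + dot d ((1 - om) * v) = dot d v := by
  rw [← dot_add]; congr 1; ring

@[fun_prop]
theorem continuous_dot (x : ℂ) : Continuous (dot x) := by
  unfold dot; fun_prop

theorem finite_circle_line {n : ℂ} (hn : n ≠ 0) (r c : ℝ) :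
    {v : ℂ | ‖v‖ = r ∧ dot n v = c}.Finite := by
  set s : ℝ := √(r ^ 2 * dot n n - c ^ 2) with hs
  have hn' : (starRingEnd ℂ) n ≠ 0 := by simpa using hn
  apply (Set.toFinite {((⟨c, s⟩ : ℂ) / (starRingEnd ℂ) n),
    ((⟨c, -s⟩ : ℂ) / (starRingEnd ℂ) n)}).subset
  rintro v ⟨rfl, rfl⟩
  set k : ℝ := n.re * v.im - n.im * v.re with hk
  have h1 : (starRingEnd ℂ) n * v = ⟨dot n v, k⟩ := by
    apply Complex.ext <;> simp [dot, hk]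
    ring
  have h2 : s = |k| := by
    rw [hs, ← Real.sqrt_sq_eq_abs]
    congr 1
    rw [← dot_self]; simp only [dot, hk]; ring
  rcases abs_choice k with h | h
  · left
    rw [eq_div_iff hn', mul_comm, h1, h2, h]
  · right
    rw [Set.mem_singleton_iff, eq_div_iff hn', mul_comm, h1, h2, h, neg_neg]

/-- A decomposition of the plane into a closed set `F` and two open sets `U`, `V` both of which
accumulate at every point of `F`, where `F` is locally contained in finitely many lines. -/
structure IsTwoColoring (F U V : Set ℂ) : Prop where
  isOpen_left : IsOpen U
  isOpen_right : IsOpen V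
  disj : Disjoint U V
  compl_eq : Fᶜ = U ∪ V
  sub_left : F ⊆ closure U
  sub_right : F ⊆ closure V
  lines : ∀ R : ℝ, ∃ L : Set (ℂ × ℝ), L.Finite ∧ (∀ l ∈ L, l.1 ≠ 0) ∧
    ∀ x ∈ F, ‖x‖ ≤ R → ∃ l ∈ L, dot l.1 x = l.2

/-- The set `U` contains no equilateral triangle of side `r`. -/
def NoEquilateral (U : Set ℂ) (r : ℝ) : Prop :=
  ∀ x v : ℂ, ‖v‖ = r → x ∈ U → x + v ∈ U → x + om * v ∉ U

/-- The segment from `A` to `A + d` is contained in `F`. -/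
def Dir (F : Set ℂ) (A d : ℂ) : Prop := ∀ t ∈ Icc (0 : ℝ) 1, A + t • d ∈ F

variable {F U V : Set ℂ} {A d v w : ℂ} {r : ℝ}

theorem Dir.left_mem (h : Dir F A d) : A ∈ F := by simpa using h 0 (by simp)

theorem Dir.smul (h : Dir F A d) {s : ℝ} (hs : s ∈ Icc (0 : ℝ) 1) : Dir F A (s • d) := by
  intro t ht
  rw [smul_smul]
  exact h _ ⟨mul_nonneg ht.1 hs.1, mul_le_one₀ ht.2 hs.1 hs.2⟩

theorem Dir.reverse (h : Dir F A d) : Dir F (A + d) (-d) := by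
  intro t ht
  have := h (1 - t) ⟨by linarith [ht.2], by linarith [ht.1]⟩
  convert this using 1
  simp; ring

namespace IsTwoColoring

theorem symm (h : IsTwoColoring F U V) : IsTwoColoring F V U :=
  ⟨h.isOpen_right, h.isOpen_left, h.disj.symm, by rw [h.compl_eq, union_comm], h.sub_right,
    h.sub_left, h.lines⟩

theorem isClosed (h : IsTwoColoring F U V) : IsClosed F := by
  rw [← isOpen_compl_iff, h.compl_eq]
  exact h.isOpen_left.union h.isOpen_right

theorem notMem_left (h : IsTwoColoring F U V) {x : ℂ} (hx : x ∈ F) : x ∉ U := fun hU =>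
  (h.compl_eq ▸ (Or.inl hU : x ∈ U ∪ V) : x ∈ Fᶜ) hx

theorem notMem_right (h : IsTwoColoring F U V) {x : ℂ} (hx : x ∈ F) : x ∉ V :=
  h.symm.notMem_left hx

theorem mem_or (h : IsTwoColoring F U V) {x : ℂ} (hx : x ∉ F) : x ∈ U ∨ x ∈ V := by
  have : x ∈ Fᶜ := hx
  rwa [h.compl_eq] at this

theorem notMem_both (h : IsTwoColoring F U V) {x : ℂ} (hU : x ∈ U) : x ∉ V :=
  fun hV => h.disj.le_bot ⟨hU, hV⟩

theorem mono_of_preconnected (h : IsTwoColoring F U V) {s : Set ℂ} (hs : IsPreconnected s)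
    (hF : ∀ x ∈ s, x ∉ F) : s ⊆ U ∨ s ⊆ V :=
  IsPreconnected.subset_or_subset h.isOpen_left h.isOpen_right h.disj
    (fun x hx => h.mem_or (hF x hx)) hs

/-- The colour is constant along a segment avoiding `F`. -/
theorem mem_of_path (h : IsTwoColoring F U V) {x y : ℂ} {f : ℝ → ℂ} (hf : Continuous f)
    {a b : ℝ} (hab : a ≤ b)
    (hF : ∀ t ∈ Icc a b, f t ∉ F) (hx : f a = x) (hy : f b = y) : x ∈ U ↔ y ∈ U := by
  have hp : IsPreconnected (f '' Icc a b) := isPreconnected_Icc.image _ hf.continuousOn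
  have hxm : x ∈ f '' Icc a b := ⟨a, by simpa using hab, hx⟩
  have hym : y ∈ f '' Icc a b := ⟨b, by simpa using hab, hy⟩
  rcases h.mono_of_preconnected hp (by rintro _ ⟨t, ht, rfl⟩; exact hF t ht) with h1 | h1
  · exact ⟨fun _ => h1 hym, fun _ => h1 hxm⟩
  · exact ⟨fun hh => absurd (h1 hxm) (h.notMem_both hh),
      fun hh => absurd (h1 hym) (h.notMem_both hh)⟩

theorem flip (h : IsTwoColoring F U V) (hU : NoEquilateral U r) (hA : A ∈ F) (hv : ‖v‖ = r)
    (h1 : A + v ∈ U) : A + om * v ∉ U := by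
  intro h2
  have ho : IsOpen ({x : ℂ | x + v ∈ U} ∩ {x : ℂ | x + om * v ∈ U}) :=
    (h.isOpen_left.preimage (by fun_prop)).inter (h.isOpen_left.preimage (by fun_prop))
  obtain ⟨x, ⟨hx1, hx2⟩, hx3⟩ := mem_closure_iff.1 (h.sub_left hA) _ ho ⟨h1, h2⟩
  exact hU x v hv hx3 hx1 hx2

theorem flip_inv (h : IsTwoColoring F U V) (hU : NoEquilateral U r) (hA : A ∈ F) (hv : ‖v‖ = r)
    (h1 : A + v ∈ U) : A + (1 - om) * v ∉ U := by
  intro h2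
  refine h.flip hU hA (by rwa [norm_one_sub_om_mul]) h2 ?_
  convert h1 using 2
  linear_combination -v * om_mul_om

theorem finite_circle (h : IsTwoColoring F U V) (A : ℂ) (r : ℝ) :
    {v : ℂ | ‖v‖ = r ∧ A + v ∈ F}.Finite := by
  obtain ⟨L, hL, hL0, hF⟩ := h.lines (‖A‖ + r)
  refine (hL.biUnion (t := fun l => {v : ℂ | ‖v‖ = r ∧ dot l.1 v = l.2 - dot l.1 A})
    fun l hl => finite_circle_line (hL0 l hl) r _).subset ?_
  rintro v ⟨hv, hvF⟩
  obtain ⟨l, hl, hlv⟩ := hF _ hvF ((norm_add_le _ _).trans (by rw [hv]))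
  refine mem_iUnion₂.2 ⟨l, hl, hv, ?_⟩
  rw [dot_add] at hlv
  linarith

/-- Near a point at which `F` is contained in a line, `F` equals this line, and it separates the
two colours. -/
theorem flat (h : IsTwoColoring F U V) {x n : ℂ} {δ : ℝ} (hn : n ≠ 0) (hx : x ∈ F) (hδ : 0 < δ)
    (hF : ∀ y ∈ ball x δ, y ∈ F → dot n y = dot n x) :
    (∀ y ∈ ball x δ, dot n y = dot n x → y ∈ F) ∧
    ((∀ y ∈ ball x δ, (dot n x < dot n y → y ∈ U) ∧ (dot n y < dot n x → y ∈ V)) ∨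
     (∀ y ∈ ball x δ, (dot n x < dot n y → y ∈ V) ∧ (dot n y < dot n x → y ∈ U))) := by
  have lin : IsLinearMap ℝ (dot n) := ⟨dot_add n, fun c y => dot_smul n c y⟩
  have key : ∀ {U V : Set ℂ}, IsTwoColoring F U V →
      (∀ y ∈ ball x δ, dot n x < dot n y → y ∈ U) →
      (∀ y ∈ ball x δ, dot n y < dot n x → y ∈ U) → False := by
    intro U V h h1 h2
    obtain ⟨y, hy1, hy2⟩ := mem_closure_iff.1 (h.sub_right hx) _ isOpen_ball (mem_ball_self hδ)
    have ho : IsOpen (ball x δ ∩ V) := isOpen_ball.inter h.isOpen_right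
    have hc : Continuous fun t : ℝ => y + t • n := by fun_prop
    have hev : ∀ᶠ t in nhds (0 : ℝ), y + t • n ∈ ball x δ ∩ V := by
      apply hc.continuousAt.eventually_mem
      apply ho.mem_nhds
      simpa using ⟨hy1, hy2⟩
    obtain ⟨η, hη, hev⟩ := Metric.eventually_nhds_iff.1 hev
    rcases lt_trichotomy (dot n y) (dot n x) with hlt | heq | hgt
    · exact h.notMem_both (h2 y hy1 hlt) hy2
    · have := hev (y := η / 2)
        (by rw [Real.dist_eq, sub_zero, abs_of_pos (by positivity)]; linarith)
      refine h.notMem_both (h1 _ this.1 ?_) this.2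
      rw [dot_add, dot_smul, heq]
      have := dot_self_pos hn
      have : 0 < η / 2 * dot n n := by positivity
      linarith
    · exact h.notMem_both (h1 y hy1 hgt) hy2
  have hp : IsPreconnected (ball x δ ∩ {y | dot n x < dot n y}) :=
    ((convex_ball x δ).inter (convex_halfSpace_gt lin _)).isPreconnected
  have hm : IsPreconnected (ball x δ ∩ {y | dot n y < dot n x}) :=
    ((convex_ball x δ).inter (convex_halfSpace_lt lin _)).isPreconnected
  have hp' := h.mono_of_preconnected hp
    (fun y hy hyF => absurd (hF y hy.1 hyF) (ne_of_gt hy.2))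
  have hm' := h.mono_of_preconnected hm
    (fun y hy hyF => absurd (hF y hy.1 hyF) (ne_of_lt hy.2))
  have side : ∀ {U V : Set ℂ}, IsTwoColoring F U V →
      ball x δ ∩ {y | dot n x < dot n y} ⊆ U → ball x δ ∩ {y | dot n y < dot n x} ⊆ V →
      ∀ y ∈ ball x δ, dot n y = dot n x → y ∈ F := by
    intro U V h h1 h2 y hy hxy
    by_contra hyF
    have hcl : ∀ {W : Set ℂ}, IsOpen W → y ∈ W → ∃ η : ℝ, 0 < η ∧
        y + η • n ∈ ball x δ ∩ W ∧ y + (-η) • n ∈ ball x δ ∩ W := by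
      intro W hW hyW
      have hc : Continuous fun t : ℝ => y + t • n := by fun_prop
      have hev : ∀ᶠ t in nhds (0 : ℝ), y + t • n ∈ ball x δ ∩ W := by
        apply hc.continuousAt.eventually_mem
        apply (isOpen_ball.inter hW).mem_nhds
        simpa using ⟨hy, hyW⟩
      obtain ⟨η, hη, hev⟩ := Metric.eventually_nhds_iff.1 hev
      refine ⟨η / 2, by positivity, hev ?_, hev ?_⟩ <;>
        simp [abs_of_pos hη] <;> linarith
    have hnn := dot_self_pos hn
    rcases h.mem_or hyF with hyU | hyV
    · obtain ⟨η, hη, -, h4⟩ := hcl h.isOpen_left hyU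
      refine h.notMem_both h4.2 (h2 ⟨h4.1, ?_⟩)
      simp only [mem_ofPred_eq, dot_add, dot_smul, hxy]
      nlinarith
    · obtain ⟨η, hη, h4, -⟩ := hcl h.isOpen_right hyV
      refine h.notMem_both (h1 ⟨h4.1, ?_⟩) h4.2
      simp only [mem_ofPred_eq, dot_add, dot_smul, hxy]
      nlinarith
  rcases hp' with hp' | hp' <;> rcases hm' with hm' | hm'
  · exact (key h (fun y hy hh => hp' ⟨hy, hh⟩)
      (fun y hy hh => hm' ⟨hy, hh⟩)).elim
  · exact ⟨side h hp' hm', Or.inl fun y hy => ⟨fun hh => hp' ⟨hy, hh⟩, fun hh => hm' ⟨hy, hh⟩⟩⟩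
  · exact ⟨side h.symm hp' hm',
      Or.inr fun y hy => ⟨fun hh => hp' ⟨hy, hh⟩, fun hh => hm' ⟨hy, hh⟩⟩⟩
  · exact (key h.symm (fun y hy hh => hp' ⟨hy, hh⟩)
      (fun y hy hh => hm' ⟨hy, hh⟩)).elim

end IsTwoColoring

end PlaneColoring

namespace PlaneColoring

open Set Metric

variable {F U V : Set ℂ} {A d v w : ℂ} {r : ℝ}

theorem dot_smul_left (t : ℝ) (x y : ℂ) : dot (t • x) y = t * dot x y := by
  rw [dot_comm, dot_smul, dot_comm]

theorem dot_rotation_eq_one {ζ m d A : ℂ} {c r : ℝ} {S : Set ℂ} {L : Set (ℂ × ℝ)} (hζ : ‖ζ‖ = 1)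
    (hL : L.Finite) (hL0 : ∀ l ∈ L, l.1 ≠ 0) (hS : S.Infinite) (hSr : ∀ v ∈ S, ‖v‖ = r)
    (hSL : ∀ v ∈ S, ∃ l ∈ L, dot l.1 (A + (c - dot m v) • d + ζ * v) = l.2) :
    dot (ζ * m) d = 1 := by
  by_contra hne
  apply hS
  have hnz : ∀ l ∈ L, (starRingEnd ℂ) ζ * l.1 - dot l.1 d • m ≠ 0 := by
    intro l hl h0
    have hζ2 : ζ * (starRingEnd ℂ) ζ = 1 := by
      rw [Complex.mul_conj, Complex.normSq_eq_norm_sq, hζ]; simp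
    have h1 : l.1 = dot l.1 d • (ζ * m) := by
      rw [sub_eq_zero] at h0
      calc l.1 = ζ * ((starRingEnd ℂ) ζ * l.1) := by rw [← mul_assoc, hζ2, one_mul]
        _ = _ := by rw [h0, mul_smul_comm]
    have h2 : dot l.1 d = dot l.1 d * dot (ζ * m) d := by
      conv_lhs => rw [h1]
      rw [dot_smul_left]
    by_cases h3 : dot l.1 d = 0
    · rw [h3, zero_smul] at h1
      exact hL0 l hl h1
    · exact hne (mul_left_cancel₀ h3 (by linarith))
  refine (hL.biUnion fun l hl => finite_circle_line (hnz l hl) r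
    (l.2 - dot l.1 (A + c • d))).subset ?_
  intro v hv
  obtain ⟨l, hl, h1⟩ := hSL v hv
  refine mem_iUnion₂.2 ⟨l, hl, hSr v hv, ?_⟩
  rw [← h1]
  simp [dot]
  ring

namespace IsTwoColoring

theorem crossing (h : IsTwoColoring F U V) (hd : Dir F A d) {t δ : ℝ} {n z : ℂ}
    (ht : t ∈ Ioo (0 : ℝ) 1) (hX : A + t • d + v ∈ F) (hn : dot n d ≠ 0) (hδ : 0 < δ)
    (hF : ∀ y ∈ ball (A + t • d + v) δ, y ∈ F → dot n y = dot n (A + t • d + v))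
    (hU : ∀ B ∈ F, B + z ∈ U → B + v ∉ U) (hV : ∀ B ∈ F, B + z ∈ V → B + v ∉ V) :
    A + t • d + z ∈ F := by
  by_contra hz
  have hn0 : n ≠ 0 := by rintro rfl; simp [dot] at hn
  have key : ∀ W : Set ℂ, IsOpen W → A + t • d + z ∈ W → (∀ B ∈ F, B + z ∈ W → B + v ∉ W) →
      ∃ y₁ ∈ ball (A + t • d + v) δ, ∃ y₂ ∈ ball (A + t • d + v) δ,
        dot n y₁ < dot n (A + t • d + v) ∧ dot n (A + t • d + v) < dot n y₂ ∧
        y₁ ∉ W ∧ y₂ ∉ W := by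
    intro W hW hz hWf
    have e1 : ∀ᶠ s in nhds t, s ∈ Ioo (0 : ℝ) 1 := isOpen_Ioo.mem_nhds ht
    have e2 : ∀ᶠ s in nhds t, A + s • d + z ∈ W :=
      (by fun_prop : Continuous fun s : ℝ => A + s • d + z).continuousAt.eventually_mem
        (hW.mem_nhds hz)
    have e3 : ∀ᶠ s in nhds t, A + s • d + v ∈ ball (A + t • d + v) δ :=
      (by fun_prop : Continuous fun s : ℝ => A + s • d + v).continuousAt.eventually_mem
        (isOpen_ball.mem_nhds (mem_ball_self hδ))
    obtain ⟨η, hη, he⟩ := Metric.eventually_nhds_iff.1 (e1.and (e2.and e3))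
    have hp := he (y := t + η / 2) (by simp [abs_of_pos hη]; linarith)
    have hm := he (y := t - η / 2) (by simp [abs_of_pos hη]; linarith)
    have hp' := hWf _ (hd _ ⟨hp.1.1.le, hp.1.2.le⟩) hp.2.1
    have hm' := hWf _ (hd _ ⟨hm.1.1.le, hm.1.2.le⟩) hm.2.1
    rcases lt_or_gt_of_ne hn with hneg | hpos
    · refine ⟨_, hp.2.2, _, hm.2.2, ?_, ?_, hp', hm'⟩ <;> simp only [dot_add, dot_smul] <;>
        nlinarith
    · refine ⟨_, hm.2.2, _, hp.2.2, ?_, ?_, hm', hp'⟩ <;> simp only [dot_add, dot_smul] <;>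
        nlinarith
  obtain ⟨-, hs⟩ := h.flat hn0 hX hδ hF
  rcases h.mem_or hz with hz | hz
  · obtain ⟨y₁, hy₁, y₂, hy₂, h1, h2, h3, h4⟩ := key U h.isOpen_left hz hU
    rcases hs with hs | hs
    · exact h4 ((hs y₂ hy₂).1 h2)
    · exact h3 ((hs y₁ hy₁).2 h1)
  · obtain ⟨y₁, hy₁, y₂, hy₂, h1, h2, h3, h4⟩ := key V h.isOpen_right hz hV
    rcases hs with hs | hs
    · exact h3 ((hs y₁ hy₁).2 h1)
    · exact h4 ((hs y₂ hy₂).1 h2)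

/-- Only finitely many circle points meet `F` while the centre moves along a segment of `F`. -/
theorem finite_bad (h : IsTwoColoring F U V) (hU : NoEquilateral U r)
    (hV : NoEquilateral V r) (hd : Dir F A d) (hd0 : d ≠ 0) :
    {v : ℂ | ‖v‖ = r ∧ ∃ t ∈ Icc (0 : ℝ) 1, A + t • d + v ∈ F}.Finite := by
  obtain ⟨L, hL, hL0, hLF⟩ := h.lines (‖A‖ + ‖d‖ + r + 1)
  have hbd : ∀ v z : ℂ, ‖v‖ = r → ∀ t ∈ Icc (0 : ℝ) 1, ‖z‖ = r →
      ‖A + t • d + z‖ < ‖A‖ + ‖d‖ + r + 1 := by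
    intro v z _ t ht hz
    have h1 : ‖t • d‖ ≤ ‖d‖ := by
      rw [norm_smul, Real.norm_of_nonneg ht.1]
      exact mul_le_of_le_one_left (norm_nonneg _) ht.2
    have := norm_add₃_le (a := A) (b := t • d) (c := z)
    linarith
  set cross : ℂ → ℂ → ℝ := fun x y => x.re * y.im - x.im * y.re with hcross
  have f1 := h.finite_circle A r
  have f2 := h.finite_circle (A + d) r
  have f3 : ∀ l ∈ L, ∀ l' ∈ L, {v : ℂ | cross l.1 l'.1 ≠ 0 ∧ ‖v‖ = r ∧ ∃ t : ℝ,
      dot l.1 (A + t • d + v) = l.2 ∧ dot l'.1 (A + t • d + v) = l'.2}.Finite := by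
    intro l hl l' hl'
    rcases Set.eq_empty_or_nonempty {v : ℂ | cross l.1 l'.1 ≠ 0 ∧ ‖v‖ = r ∧ ∃ t : ℝ,
      dot l.1 (A + t • d + v) = l.2 ∧ dot l'.1 (A + t • d + v) = l'.2} with he |
        ⟨v₀, hc, -, t₀, h1, h2⟩
    · rw [he]; exact finite_empty
    · refine (finite_circle_line (n := Complex.I * d) (by simpa using hd0) r
        (dot (Complex.I * d) v₀)).subset ?_
      rintro v ⟨-, hv, t, h3, h4⟩
      refine ⟨hv, ?_⟩
      rw [← h1] at h3
      rw [← h2] at h4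
      simp only [dot, Complex.add_re, Complex.add_im, Complex.real_smul, Complex.mul_re,
        Complex.mul_im, Complex.ofReal_re, Complex.ofReal_im, Complex.I_re, Complex.I_im] at *
      have hx : t * d.re + v.re = t₀ * d.re + v₀.re := by
        apply mul_left_cancel₀ hc
        simp only [hcross]
        linear_combination l'.1.im * h3 - l.1.im * h4
      have hy : t * d.im + v.im = t₀ * d.im + v₀.im := by
        apply mul_left_cancel₀ hc
        simp only [hcross]
        linear_combination -l'.1.re * h3 + l.1.re * h4
      linear_combination d.re * hy - d.im * hx
  have f4 : ∀ l ∈ L, {v : ℂ | ‖v‖ = r ∧ ∃ t ∈ Ioo (0 : ℝ) 1, A + t • d + v ∈ F ∧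
      dot l.1 (A + t • d + v) = l.2 ∧
      ∀ l' ∈ L, dot l'.1 (A + t • d + v) = l'.2 → cross l.1 l'.1 = 0}.Finite := by
    intro l hl
    by_cases hnd : dot l.1 d = 0
    · refine (finite_circle_line (hL0 l hl) r (l.2 - dot l.1 A)).subset ?_
      rintro v ⟨hv, t, -, -, h1, -⟩
      refine ⟨hv, ?_⟩
      rw [dot_add, dot_add, dot_smul, hnd] at h1
      linarith
    · by_contra hinf
      set S := {v : ℂ | ‖v‖ = r ∧ ∃ t ∈ Ioo (0 : ℝ) 1, A + t • d + v ∈ F ∧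
        dot l.1 (A + t • d + v) = l.2 ∧
        ∀ l' ∈ L, dot l'.1 (A + t • d + v) = l'.2 → cross l.1 l'.1 = 0} with hS
      set m : ℂ := (dot l.1 d)⁻¹ • l.1 with hm
      have hmd : dot m d = 1 := by rw [hm, dot_smul_left, inv_mul_cancel₀ hnd]
      set c : ℝ := (dot l.1 d)⁻¹ * (l.2 - dot l.1 A) with hc
      have main : ∀ v ∈ S, ∀ z : ℂ, ‖z‖ = r → (∀ B ∈ F, B + z ∈ U → B + v ∉ U) →
          (∀ B ∈ F, B + z ∈ V → B + v ∉ V) →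
          ∃ l ∈ L, dot l.1 (A + (c - dot m v) • d + z) = l.2 := by
        rintro v ⟨hv, t, ht, hX, h1, h2⟩ z hz hzU hzV
        have htc : c - dot m v = t := by
          rw [hc, hm, dot_smul_left, ← mul_sub, ← h1, dot_add, dot_add, dot_smul]
          field_simp
          ring
        rw [htc]
        have ht' : t ∈ Icc (0 : ℝ) 1 := ⟨ht.1.le, ht.2.le⟩
        have e1 : ∀ᶠ y in nhds (A + t • d + v), ∀ l' ∈ L, dot l'.1 (A + t • d + v) ≠ l'.2 →
            dot l'.1 y ≠ l'.2 := by
          rw [Filter.eventually_all_finite hL]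
          intro l' hl'
          by_cases hll : dot l'.1 (A + t • d + v) = l'.2
          · exact Filter.Eventually.of_forall fun y hne => absurd hll hne
          · filter_upwards [(continuous_dot l'.1).continuousAt.eventually_ne hll] with y hy _
            exact hy
        have e2 : ∀ᶠ y in nhds (A + t • d + v), ‖y‖ < ‖A‖ + ‖d‖ + r + 1 :=
          continuous_norm.continuousAt.eventually_lt continuousAt_const (hbd v v hv t ht' hv)
        obtain ⟨δ, hδ, he⟩ := Metric.eventually_nhds_iff.1 (e1.and e2)
        refine hLF _ (h.crossing hd ht hX hnd hδ ?_ hzU hzV) (hbd v z hv t ht' hz).le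
        intro y hy hyF
        obtain ⟨he1, he2⟩ := he hy
        obtain ⟨l', hl', hly⟩ := hLF y hyF he2.le
        have h3 : dot l'.1 (A + t • d + v) = l'.2 := by
          by_contra h3
          exact he1 l' hl' h3 hly
        have h4 := h2 l' hl' h3
        rw [← h3] at hly
        have h5 := hL0 l' hl'
        generalize A + t • d + v = X at *
        simp only [dot, hcross] at hly h4 ⊢
        have : l'.1.re ≠ 0 ∨ l'.1.im ≠ 0 := by
          by_contra! hh
          exact h5 (Complex.ext hh.1 hh.2)
        rcases this with hh | hh
        · apply mul_left_cancel₀ hh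
          linear_combination l.1.re * hly + (X.im - y.im) * h4
        · apply mul_left_cancel₀ hh
          linear_combination l.1.im * hly + (y.re - X.re) * h4
      have k1 := dot_rotation_eq_one (c := c) (m := m) (A := A) norm_om hL hL0 hinf
        (fun v hv => hv.1) fun v hv => by
          apply main v hv _ (by rw [norm_om_mul, hv.1])
          · intro B hB h1 h2; exact h.flip hU hB hv.1 h2 h1
          · intro B hB h1 h2; exact h.symm.flip hV hB hv.1 h2 h1
      have k2 := dot_rotation_eq_one (ζ := 1 - om) (c := c) (m := m) (A := A)
        (by simpa using norm_one_sub_om_mul 1) hL hL0 hinf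
        (fun v hv => hv.1) fun v hv => by
          apply main v hv _ (by rw [norm_one_sub_om_mul, hv.1])
          · intro B hB h1 h2; exact h.flip_inv hU hB hv.1 h2 h1
          · intro B hB h1 h2; exact h.symm.flip_inv hV hB hv.1 h2 h1
      have k3 := dot_om_add d m
      rw [dot_comm, k1, dot_comm, k2, dot_comm, hmd] at k3
      norm_num at k3
  refine ((f1.union f2).union ((hL.biUnion fun l hl => hL.biUnion (f3 l hl)).union
    (hL.biUnion f4))).subset ?_
  rintro v ⟨hv, t, ht, hX⟩
  by_cases t0 : t = 0
  · exact Or.inl (Or.inl ⟨hv, by simpa [t0] using hX⟩)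
  by_cases t1 : t = 1
  · exact Or.inl (Or.inr ⟨hv, by simpa [t1] using hX⟩)
  obtain ⟨l, hl, hlX⟩ := hLF _ hX (hbd v v hv t ht hv).le
  by_cases hp : ∀ l' ∈ L, dot l'.1 (A + t • d + v) = l'.2 → cross l.1 l'.1 = 0
  · exact Or.inr (Or.inr (mem_iUnion₂.2 ⟨l, hl, hv, t,
      ⟨lt_of_le_of_ne ht.1 (Ne.symm t0), lt_of_le_of_ne ht.2 t1⟩, hX, hlX, hp⟩))
  · push Not at hp
    obtain ⟨l', hl', h1, h2⟩ := hp
    exact Or.inr (Or.inl (mem_iUnion₂.2 ⟨l, hl, mem_iUnion₂.2 ⟨l', hl', h2, hv, t, hlX, h1⟩⟩))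

end IsTwoColoring

end PlaneColoring

namespace PlaneColoring

open Set Metric

variable {F U V : Set ℂ} {A d d' v w : ℂ} {r : ℝ}

/-- Every neighbourhood of a point of a circle contains points of the circle outside a given
finite set. -/
theorem exists_circle_near (hr : 0 < r) (hv : ‖v‖ = r) {W S : Set ℂ} (hW : IsOpen W)
    (hvW : v ∈ W) (hS : S.Finite) : ∃ w ∈ W, ‖w‖ = r ∧ w ∉ S := by
  have hv0 : v ≠ 0 := by rintro rfl; simp at hv; linarith
  have hc : Continuous fun θ : ℝ => Complex.exp (θ * Complex.I) * v := by fun_prop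
  have he : ∀ᶠ θ : ℝ in nhds (0 : ℝ), Complex.exp ((θ : ℂ) * Complex.I) * v ∈ W :=
    hc.continuousAt.eventually_mem (hW.mem_nhds (by simpa using hvW))
  obtain ⟨η, hη, he⟩ := Metric.eventually_nhds_iff.1 he
  have hinj : InjOn (fun θ : ℝ => Complex.exp (θ * Complex.I) * v) (Ioo 0 (min η 1)) := by
    intro a ha b hb hab
    have h1 := mul_right_cancel₀ hv0 hab
    have hpi := Real.pi_gt_three
    have ha2 := lt_of_lt_of_le ha.2 (min_le_right _ _)
    have hb2 := lt_of_lt_of_le hb.2 (min_le_right _ _)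
    have h2 := Complex.exp_inj_of_neg_pi_lt_of_le_pi (x := a * Complex.I) (y := b * Complex.I)
      (by simp; linarith [ha.1]) (by simp; linarith) (by simp; linarith [hb.1])
      (by simp; linarith) h1
    simpa using congrArg Complex.im h2
  have hinf := (Ioo_infinite (show (0 : ℝ) < min η 1 by positivity)).image hinj
  obtain ⟨_, ⟨θ, hθ, rfl⟩, hS'⟩ := hinf.exists_notMem_finite hS
  refine ⟨_, he ?_, ?_, hS'⟩
  · rw [Real.dist_eq, sub_zero, abs_of_pos hθ.1]
    exact lt_of_lt_of_le hθ.2 (min_le_left _ _)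
  · simp [Complex.norm_exp_ofReal_mul_I, hv]

/-- A two-coloring without equilateral triangles of side `r` in either colour. -/
structure Avoiding (F U V : Set ℂ) (r : ℝ) : Prop where
  col : IsTwoColoring F U V
  pos : 0 < r
  left : NoEquilateral U r
  right : NoEquilateral V r

/-- The vectors of length `r` leading from `A` into `U`. -/
def arc (U : Set ℂ) (r : ℝ) (A : ℂ) : Set ℂ := {w | ‖w‖ = r ∧ A + w ∈ U}

/-- The vectors from `A` to the points at which the circle of radius `r` around `A` switches
between `U` and `V`. -/
def switch (U V : Set ℂ) (r : ℝ) (A : ℂ) : Set ℂ := closure (arc U r A) ∩ closure (arc V r A)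

theorem norm_of_mem_switch (hv : v ∈ switch U V r A) : ‖v‖ = r :=
  closure_minimal (fun _ hw => hw.1) (isClosed_eq continuous_norm continuous_const) hv.1

namespace Avoiding

theorem symm (h : Avoiding F U V r) : Avoiding F V U r := ⟨h.col.symm, h.pos, h.right, h.left⟩

theorem mem_of_switch (h : Avoiding F U V r) (hv : v ∈ switch U V r A) : A + v ∈ F := by
  by_contra hF
  have key : ∀ {U V : Set ℂ}, Avoiding F U V r → A + v ∈ U → v ∉ closure (arc V r A) := by
    intro U V h hU hcl
    obtain ⟨w, hw, -, hwV⟩ := mem_closure_iff.1 hcl {w | A + w ∈ U}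
      (h.col.isOpen_left.preimage (by fun_prop)) hU
    exact h.col.notMem_both hw hwV
  rcases h.col.mem_or hF with hU | hV
  · exact key h hU hv.2
  · exact key h.symm hV hv.1

theorem om_mul_mem_closure (h : Avoiding F U V r) (hA : A ∈ F) (hv : v ∈ closure (arc U r A)) :
    om * v ∈ closure (arc V r A) := by
  rw [_root_.mem_closure_iff]
  intro W hW hvW
  obtain ⟨w, hwW, hwr, hwU⟩ := mem_closure_iff.1 hv {w | om * w ∈ W}
    (hW.preimage (by fun_prop)) hvW
  have hom : om ≠ 0 := by
    intro h0; have := norm_om; simp [h0] at this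
  have hfin : {w : ℂ | ‖om * w‖ = r ∧ A + om * w ∈ F}.Finite :=
    (h.col.finite_circle A r).preimage (f := fun w => om * w)
      (fun a _ b _ hab => mul_left_cancel₀ hom hab)
  obtain ⟨w', ⟨h1, h2⟩, h3, h4⟩ := exists_circle_near h.pos hwr
    (W := {w | om * w ∈ W} ∩ {w | A + w ∈ U})
    ((hW.preimage (by fun_prop)).inter (h.col.isOpen_left.preimage (by fun_prop)))
    ⟨hwW, hwU⟩ hfin
  refine ⟨om * w', h1, by rwa [norm_om_mul], ?_⟩
  refine (h.col.mem_or fun hF => h4 ⟨by rwa [norm_om_mul], hF⟩).resolve_left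
    (h.col.flip h.left hA h3 h2)

theorem om_mul_mem_switch (h : Avoiding F U V r) (hA : A ∈ F) (hv : v ∈ switch U V r A) :
    om * v ∈ switch U V r A :=
  ⟨h.symm.om_mul_mem_closure hA hv.2, h.om_mul_mem_closure hA hv.1⟩

theorem neg_mem_switch (h : Avoiding F U V r) (hA : A ∈ F) (hv : v ∈ switch U V r A) :
    -v ∈ switch U V r A := by
  have := h.om_mul_mem_switch hA (h.om_mul_mem_switch hA (h.om_mul_mem_switch hA hv))
  convert this using 1
  linear_combination (-v - v * om) * om_mul_om

theorem one_sub_om_mul_mem_switch (h : Avoiding F U V r) (hA : A ∈ F)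
    (hv : v ∈ switch U V r A) : (1 - om) * v ∈ switch U V r A := by
  have := h.neg_mem_switch hA (h.om_mul_mem_switch hA (h.om_mul_mem_switch hA hv))
  convert this using 1
  linear_combination v * om_mul_om

theorem mem_closure_arc (h : Avoiding F U V r) (hv : ‖v‖ = r) :
    v ∈ closure (arc U r A) ∪ closure (arc V r A) := by
  rw [← closure_union, _root_.mem_closure_iff]
  intro W hW hvW
  obtain ⟨w, h1, h2, h3⟩ := exists_circle_near h.pos hv hW hvW (h.col.finite_circle A r)
  refine ⟨w, h1, ?_⟩
  rcases h.col.mem_or fun hF => h3 ⟨h2, hF⟩ with hh | hh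
  · exact Or.inl ⟨h2, hh⟩
  · exact Or.inr ⟨h2, hh⟩

theorem switch_nonempty (h : Avoiding F U V r) (hA : A ∈ F) : (switch U V r A).Nonempty := by
  have hs : IsPreconnected (sphere (0 : ℂ) r) :=
    isPreconnected_sphere (by rw [Complex.rank_real_complex]; norm_num) _ _
  have hr : ‖(r : ℂ)‖ = r := by simp [abs_of_pos h.pos]
  have hr' : ‖om * (r : ℂ)‖ = r := by rw [norm_om_mul, hr]
  have := isPreconnected_closed_iff.1 hs (closure (arc U r A)) (closure (arc V r A))
    isClosed_closure isClosed_closure (fun v hv => h.mem_closure_arc (by simpa using hv))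
  have hne : (sphere (0 : ℂ) r ∩ (closure (arc U r A) ∩ closure (arc V r A))).Nonempty := by
    rcases h.mem_closure_arc (A := A) hr with h1 | h1
    · exact this ⟨r, mem_sphere_zero_iff_norm.2 hr, h1⟩
        ⟨om * r, mem_sphere_zero_iff_norm.2 hr', h.om_mul_mem_closure hA h1⟩
    · exact this ⟨om * r, mem_sphere_zero_iff_norm.2 hr', h.symm.om_mul_mem_closure hA h1⟩
        ⟨r, mem_sphere_zero_iff_norm.2 hr, h1⟩
  exact hne.mono inter_subset_right

/-- Sliding the centre along a segment of `F` preserves, up to perturbation, the colours on the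
circle. -/
theorem slide (h : Avoiding F U V r) (hd : Dir F A d) {t : ℝ} (ht : t ∈ Icc (0 : ℝ) 1)
    {W : Set ℂ} (hW : IsOpen W) (hw : w ∈ W) (hwr : ‖w‖ = r) (hU : A + t • d + w ∈ U) :
    (W ∩ arc U r A).Nonempty := by
  by_cases hd0 : d = 0
  · exact ⟨w, hw, hwr, by simpa [hd0] using hU⟩
  obtain ⟨w', ⟨h1, h2⟩, h3, h4⟩ := exists_circle_near h.pos hwr
    (W := W ∩ {w | A + t • d + w ∈ U})
    (hW.inter (h.col.isOpen_left.preimage (by fun_prop)))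
    ⟨hw, hU⟩ (h.col.finite_bad h.left h.right hd hd0)
  refine ⟨w', h1, h3, ?_⟩
  refine (h.col.mem_of_path (f := fun s : ℝ => A + s • d + w') (by fun_prop) ht.1 ?_
    (by simp) rfl).2 h2
  intro s hs hF
  exact h4 ⟨h3, s, ⟨hs.1, hs.2.trans ht.2⟩, hF⟩

theorem closure_arc_subset (h : Avoiding F U V r) (hd : Dir F A d) :
    closure (arc U r (A + d)) ⊆ closure (arc U r A) := by
  intro v hv
  rw [_root_.mem_closure_iff] at hv ⊢
  intro W hW hvW
  obtain ⟨w, hwW, hwr, hwU⟩ := hv W hW hvW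
  exact h.slide hd (t := 1) (by simp) hW hwW hwr (by simpa using hwU)

theorem switch_eq (h : Avoiding F U V r) (hd : Dir F A d) :
    switch U V r (A + d) = switch U V r A := by
  have key : ∀ {B e : ℂ}, Dir F B e → switch U V r (B + e) ⊆ switch U V r B := fun hd =>
    inter_subset_inter (h.closure_arc_subset hd) (h.symm.closure_arc_subset hd)
  refine (key hd).antisymm ?_
  have := key hd.reverse
  rwa [add_neg_cancel_right] at this

theorem mem_closure_arc_of_dirs (h : Avoiding F U V r) (hd : Dir F A d) (hd' : Dir F A d')
    (hdw : 0 < dot d w) (hdw' : dot d' w < 0) (hw : ‖w‖ = r) (hF : A + w ∈ F) :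
    w ∈ closure (arc U r A) := by
  rw [_root_.mem_closure_iff]
  intro W hW hwW
  obtain ⟨η, hη, hball⟩ := Metric.isOpen_iff.1 hW w hwW
  obtain ⟨s, hs0, hs1, hsd, hsd', hs2⟩ : ∃ s : ℝ, 0 < s ∧ s ≤ 1 ∧ s * ‖d‖ < η / 2 ∧
      s * ‖d'‖ < η / 2 ∧ s * dot d d < 2 * dot d w := by
    have e : ∀ᶠ s in nhdsWithin (0 : ℝ) (Ioi 0), s < 1 ∧ s * ‖d‖ < η / 2 ∧
        s * ‖d'‖ < η / 2 ∧ s * dot d d < 2 * dot d w := by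
      apply Filter.Eventually.filter_mono nhdsWithin_le_nhds
      have c : ∀ {a b : ℝ}, 0 < b → ∀ᶠ s in nhds (0 : ℝ), s * a < b := fun {a b} hb =>
        (by fun_prop : Continuous fun s : ℝ => s * a).continuousAt.eventually_lt
          continuousAt_const (by simpa using hb)
      filter_upwards [c (a := 1) one_pos, c (half_pos hη), c (half_pos hη),
        c (by linarith : 0 < 2 * dot d w)] with s h1 h2 h3 h4
      exact ⟨by simpa using h1, h2, h3, h4⟩
    obtain ⟨s, hs, hs0⟩ := (e.and self_mem_nhdsWithin).exists
    exact ⟨s, hs0, hs.1.le, hs.2⟩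
  have n1 : ‖w - s • d‖ < r := by
    rw [← hw]
    apply lt_of_pow_lt_pow_left₀ 2 (norm_nonneg _)
    rw [norm_sub_sq', dot_smul, norm_smul, mul_pow, ← dot_self d, Real.norm_of_nonneg hs0.le,
      dot_comm w]
    nlinarith
  have n2 : r < ‖w - s • d'‖ := by
    rw [← hw]
    apply lt_of_pow_lt_pow_left₀ 2 (norm_nonneg _)
    rw [norm_sub_sq', dot_smul, dot_comm w]
    nlinarith [sq_nonneg ‖s • d'‖]
  have ho : IsOpen ({y : ℂ | ‖y - A - w‖ < η / 2} ∩
      ({y : ℂ | ‖y - A - s • d‖ < r} ∩ {y : ℂ | r < ‖y - A - s • d'‖})) :=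
    (isOpen_lt (by fun_prop) (by fun_prop)).inter
      ((isOpen_lt (by fun_prop) (by fun_prop)).inter (isOpen_lt (by fun_prop) (by fun_prop)))
  obtain ⟨y, ⟨hy1, hy2, hy3⟩, hyU⟩ := mem_closure_iff.1 (h.col.sub_left hF) _ ho
    ⟨by simpa using hη, by simpa using n1, by simpa using n2⟩
  rw [mem_ofPred_eq] at hy1 hy2 hy3
  have fin : ∀ e : ℂ, Dir F A e → s * ‖e‖ < η / 2 → ∀ τ ∈ Icc 0 s, ‖y - A - τ • e‖ = r →
      (W ∩ arc U r A).Nonempty := by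
    intro e he hse τ hτ hr
    refine h.slide he (t := τ) ⟨hτ.1, hτ.2.trans hs1⟩ hW (hball ?_) hr (by simpa using hyU)
    rw [mem_ball, dist_eq_norm]
    have e1 : ‖τ • e‖ ≤ s * ‖e‖ := by
      rw [norm_smul, Real.norm_of_nonneg hτ.1]
      exact mul_le_mul_of_nonneg_right hτ.2 (norm_nonneg _)
    have e2 := norm_sub_le (y - A - w) (τ • e)
    rw [show y - A - τ • e - w = y - A - w - τ • e by ring]
    linarith
  have hc : ∀ e : ℂ, ContinuousOn (fun τ : ℝ => ‖y - A - τ • e‖) (Icc 0 s) := fun e => by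
    fun_prop
  rcases le_total r ‖y - A‖ with hle | hle
  · obtain ⟨τ, hτ, hτr⟩ := intermediate_value_Icc' hs0.le (hc d)
      (show r ∈ Icc _ _ from ⟨hy2.le, by simpa using hle⟩)
    exact fin d hd hsd τ hτ hτr
  · obtain ⟨τ, hτ, hτr⟩ := intermediate_value_Icc hs0.le (hc d')
      (show r ∈ Icc _ _ from ⟨by simpa using hle, hy3.le⟩)
    exact fin d' hd' hsd' τ hτ hτr

/-- A point of `F` on the circle which is crossed in both directions is a switch point. -/
theorem mem_switch_of_dirs (h : Avoiding F U V r) (hd : Dir F A d) (hd' : Dir F A d')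
    (hdw : 0 < dot d w) (hdw' : dot d' w < 0) (hw : ‖w‖ = r) (hF : A + w ∈ F) :
    w ∈ switch U V r A :=
  ⟨h.mem_closure_arc_of_dirs hd hd' hdw hdw' hw hF,
    h.symm.mem_closure_arc_of_dirs hd hd' hdw hdw' hw hF⟩

end Avoiding

end PlaneColoring

namespace PlaneColoring

open Set Metric

variable {F U V : Set ℂ} {A d d' v w : ℂ} {r : ℝ}

namespace Avoiding

/-- Two branches of `F` at `A` on the same side of a switch direction are parallel. -/
theorem parallel_of_pos (h : Avoiding F U V r) (hv : v ∈ switch U V r A) (hd : Dir F A d)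
    (hd' : Dir F A d') (hdv : 0 < dot d v) (hdv' : 0 < dot d' v) :
    dot d v • d' = dot d' v • d := by
  have hd0 : d ≠ 0 := by rintro rfl; simp [dot] at hdv
  have hvr := norm_of_mem_switch hv
  have hcr : dot (Complex.I * d) d' = 0 := by
    by_contra hcr
    have hfin := h.col.finite_bad h.left h.right hd hd0
    obtain ⟨s₀, hs0, hs1, hs2⟩ : ∃ s₀ : ℝ, 0 < s₀ ∧ s₀ ≤ 1 ∧ ‖v - s₀ • d‖ < r := by
      have hdd := dot_self_pos hd0
      refine ⟨min 1 (dot d v / dot d d), by positivity, min_le_left _ _, ?_⟩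
      have h1 : min 1 (dot d v / dot d d) * dot d d ≤ dot d v := by
        rw [← le_div_iff₀ hdd]; exact min_le_right _ _
      have h2 : 0 < min 1 (dot d v / dot d d) := by positivity
      rw [← hvr]
      apply lt_of_pow_lt_pow_left₀ 2 (norm_nonneg _)
      rw [norm_sub_sq', dot_smul, norm_smul, mul_pow, ← dot_self d, Real.norm_of_nonneg h2.le,
        dot_comm v]
      nlinarith
    have hev : ∀ᶠ s in nhds (0 : ℝ), ‖v + s • d' - s₀ • d‖ < r :=
      (by fun_prop : Continuous fun s : ℝ => ‖v + s • d' - s₀ • d‖).continuousAt.eventually_lt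
        continuousAt_const (by simpa using hs2)
    obtain ⟨η, hη, hev⟩ := Metric.eventually_nhds_iff.1 hev
    refine (Ioo_infinite (show (0 : ℝ) < min η 1 by positivity)) ((hfin.image fun w =>
      (dot (Complex.I * d) w - dot (Complex.I * d) v) / dot (Complex.I * d) d').subset ?_)
    intro s hs
    have hs' : s < 1 := lt_of_lt_of_le hs.2 (min_le_right _ _)
    have hlt := hev (y := s) (by
      rw [Real.dist_eq, sub_zero, abs_of_pos hs.1]; exact lt_of_lt_of_le hs.2 (min_le_left _ _))
    have hge : r ≤ ‖v + s • d'‖ := by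
      rw [← hvr]
      apply le_of_sq_le_sq _ (norm_nonneg _)
      have := norm_sub_sq' v (-(s • d'))
      rw [sub_neg_eq_add, dot_neg, dot_smul, dot_comm v, norm_neg] at this
      rw [this]
      nlinarith [sq_nonneg ‖s • d'‖, mul_pos hs.1 hdv']
    have hc : ContinuousOn (fun τ : ℝ => ‖v + s • d' - τ • d‖) (Icc 0 s₀) := by fun_prop
    obtain ⟨τ, hτ, hτr⟩ := intermediate_value_Icc' hs0.le hc
      (show r ∈ Icc _ _ from ⟨hlt.le, by simpa using hge⟩)
    refine ⟨v + s • d' - τ • d, ⟨hτr, τ, ⟨hτ.1, hτ.2.trans hs1⟩, ?_⟩, ?_⟩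
    · have hsd := hd'.smul ⟨hs.1.le, hs'.le⟩
      have := h.mem_of_switch (A := A + s • d') (by rwa [h.switch_eq hsd])
      convert this using 1
      ring
    · have : dot (Complex.I * d) d = 0 := by simp [dot]; ring
      simp only [dot_sub, dot_add, dot_smul, this]
      field_simp
      ring
  apply Complex.ext <;> simp [dot] at hcr ⊢
  · linear_combination -v.im * hcr
  · linear_combination v.re * hcr

theorem parallel_of_neg (h : Avoiding F U V r) (hv : v ∈ switch U V r A) (hd : Dir F A d)
    (hd' : Dir F A d') (hdv : dot d v < 0) (hdv' : dot d' v < 0) :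
    dot d v • d' = dot d' v • d := by
  have := h.parallel_of_pos (h.neg_mem_switch hd.left_mem hv) hd hd' (by rw [dot_neg]; linarith)
    (by rw [dot_neg]; linarith)
  rwa [dot_neg, dot_neg, neg_smul, neg_smul, neg_inj] at this

/-- A branch of `F` is never perpendicular to a switch direction. -/
theorem dot_ne_zero (h : Avoiding F U V r) (hv : v ∈ switch U V r A) (hd : Dir F A d)
    (hd0 : d ≠ 0) : dot d v ≠ 0 := by
  intro hdv
  have hvr := norm_of_mem_switch hv
  have hv0 : v ≠ 0 := by rintro rfl; have := h.pos; simp at hvr; linarith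
  have hfin := h.col.finite_bad h.left h.right hd hd0
  set κ : ℝ := dot (Complex.I * d) v / dot d d with hκ
  have hdd := dot_self_pos hd0
  have hvκ : v = κ • (Complex.I * d) := by
    have h1 : dot d d • v = dot (Complex.I * d) v • (Complex.I * d) := by
      apply Complex.ext <;> simp [dot] at hdv ⊢
      · linear_combination d.re * hdv
      · linear_combination d.im * hdv
    rw [hκ, div_eq_inv_mul, mul_smul, ← h1, smul_smul, inv_mul_cancel₀ hdd.ne', one_smul]
  set g : ℝ → ℂ := fun θ => Complex.exp (θ * Complex.I) * v with hg
  have hgc : Continuous g := by fun_prop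
  have hg0 : g 0 = v := by simp [hg]
  have hgr : ∀ θ, ‖g θ‖ = r := fun θ => by simp [hg, Complex.norm_exp_ofReal_mul_I, hvr]
  have hrefl : ∀ θ, g θ = g (-θ) + (-2 * κ * Real.sin θ) • d := by
    intro θ
    simp only [hg]
    rw [hvκ, Complex.exp_mul_I, Complex.exp_mul_I]
    apply Complex.ext <;> simp [-Complex.ofReal_cos, -Complex.ofReal_sin,
      ← Complex.ofReal_cos, ← Complex.ofReal_sin] <;> ring
  have hgW : ∀ η > 0, ∃ W : Set ℂ, IsOpen W ∧ v ∈ W ∧ ∀ w ∈ W, ‖w‖ = r →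
      ∃ θ, |θ| < η ∧ w = g θ := by
    intro η hη
    have hca : ContinuousAt (fun w : ℂ => |Complex.arg (w / v)|) v := by
      refine ContinuousAt.abs (ContinuousAt.comp (g := Complex.arg) (f := fun w => w / v) ?_
        (by fun_prop))
      apply Complex.continuousAt_arg
      rw [div_self hv0]; exact Complex.one_mem_slitPlane
    have hev := hca.eventually_lt continuousAt_const
      (show |Complex.arg (v / v)| < η by simpa [hv0] using hη)
    obtain ⟨W, hW1, hW2, hW3⟩ := _root_.mem_nhds_iff.1 hev
    refine ⟨W, hW2, hW3, fun w hw hwr => ⟨_, hW1 hw, ?_⟩⟩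
    have h1 := Complex.norm_mul_exp_arg_mul_I (w / v)
    rw [norm_div, hwr, hvr, div_self h.pos.ne', Complex.ofReal_one, one_mul] at h1
    simp only [hg, h1]
    field_simp
  have e1 : ∀ᶠ θ in nhds (0 : ℝ), |-2 * κ * Real.sin θ| < 1 :=
    (by fun_prop : Continuous fun θ : ℝ => |-2 * κ * Real.sin θ|).continuousAt.eventually_lt
      continuousAt_const (by simp)
  have e2 : ∀ᶠ θ in nhds (0 : ℝ), ∀ w ∈ {v : ℂ | ‖v‖ = r ∧ ∃ t ∈ Icc (0 : ℝ) 1, A + t • d + v ∈ F},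
      w ≠ v → g θ ≠ w := by
    rw [Filter.eventually_all_finite hfin]
    intro w _
    by_cases hwv : w = v
    · exact Filter.Eventually.of_forall fun θ hne => absurd hwv hne
    · filter_upwards [hgc.continuousAt.eventually_ne (by rw [hg0]; exact Ne.symm hwv)] with θ h1 _
      exact h1
  obtain ⟨η', hη', he⟩ := Metric.eventually_nhds_iff.1 (e1.and e2)
  set η := min η' 1 with hη
  have hηp : 0 < η := by positivity
  have hgne : ∀ θ, θ ≠ 0 → |θ| < η → g θ ≠ v := by
    intro θ h0 hθ heq
    have h1 : Complex.exp (θ * Complex.I) = 1 := by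
      apply mul_right_cancel₀ hv0
      rw [one_mul]; exact heq
    have hpi := Real.pi_gt_three
    have hθ1 := abs_lt.1 (hθ.trans_le (min_le_right _ _))
    have h2 := Complex.exp_inj_of_neg_pi_lt_of_le_pi (x := θ * Complex.I) (y := 0)
      (by simp; linarith [hθ1.1]) (by simp; linarith [hθ1.2]) (by simp; linarith)
      (by simp; linarith) (by rw [h1, Complex.exp_zero])
    exact h0 (by simpa using h2)
  have havoid : ∀ θ, θ ≠ 0 → |θ| < η → ∀ t ∈ Icc (0 : ℝ) 1, A + t • d + g θ ∉ F := by
    intro θ h0 hθ t ht hF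
    exact (he (y := θ) (by rw [Real.dist_eq, sub_zero]; exact hθ.trans_le (min_le_left _ _))).2
      (g θ) ⟨hgr θ, t, ht, hF⟩ (hgne θ h0 hθ) rfl
  have hsym : ∀ θ, θ ≠ 0 → |θ| < η → (A + g θ ∈ U ↔ A + g (-θ) ∈ U) := by
    have key : ∀ θ, θ ≠ 0 → |θ| < η → 0 ≤ -2 * κ * Real.sin θ →
        (A + g (-θ) ∈ U ↔ A + g θ ∈ U) := by
      intro θ h0 hθ hk
      have h1 := (he (y := θ)
        (by rw [Real.dist_eq, sub_zero]; exact hθ.trans_le (min_le_left _ _))).1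
      rw [abs_of_nonneg hk] at h1
      refine h.col.mem_of_path (f := fun t : ℝ => A + t • d + g (-θ)) (by fun_prop) hk ?_
        (by simp) (by rw [hrefl θ]; ring)
      intro t ht
      exact havoid (-θ) (by simpa using h0) (by rwa [abs_neg]) t ⟨ht.1, ht.2.trans h1.le⟩
    intro θ h0 hθ
    rcases le_total 0 (-2 * κ * Real.sin θ) with hk | hk
    · exact (key θ h0 hθ hk).symm
    · have := key (-θ) (by simpa using h0) (by rwa [abs_neg]) (by rw [Real.sin_neg]; linarith)
      rwa [neg_neg] at this
  have hmono : ∀ θ₁ θ₂, 0 < θ₁ → θ₁ ≤ θ₂ → θ₂ < η → (A + g θ₁ ∈ U ↔ A + g θ₂ ∈ U) := by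
    intro θ₁ θ₂ h0 h1 h2
    refine h.col.mem_of_path (f := fun θ => A + g θ) (by fun_prop) h1 ?_ rfl rfl
    intro θ hθ
    have hθ0 : 0 < θ := h0.trans_le hθ.1
    have := havoid θ hθ0.ne' (by rw [abs_of_pos hθ0]; exact hθ.2.trans_lt h2) 0 (by simp)
    simpa using this
  obtain ⟨W, hW, hvW, hWg⟩ := hgW η hηp
  have hAv := h.mem_of_switch hv
  have hex : ∀ {U' : Set ℂ}, v ∈ closure (arc U' r A) → A + v ∉ U' →
      ∃ θ, θ ≠ 0 ∧ |θ| < η ∧ A + g θ ∈ U' := by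
    intro U' hcl hU'
    obtain ⟨w, hwW, hwr, hwU⟩ := mem_closure_iff.1 hcl W hW hvW
    obtain ⟨θ, hθ, rfl⟩ := hWg w hwW hwr
    refine ⟨θ, ?_, hθ, hwU⟩
    rintro rfl
    rw [hg0] at hwU
    exact hU' hwU
  obtain ⟨θ₁, h10, h1η, h1U⟩ := hex hv.1 (h.col.notMem_left hAv)
  obtain ⟨θ₂, h20, h2η, h2V⟩ := hex hv.2 (h.col.notMem_right hAv)
  have h2U := h.col.symm.notMem_both h2V
  have habs : ∀ θ, θ ≠ 0 → |θ| < η → (A + g |θ| ∈ U ↔ A + g θ ∈ U) := by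
    intro θ h0 hθ
    rcases abs_choice θ with hh | hh
    · rw [hh]
    · rw [hh]; exact (hsym θ h0 hθ).symm
  rw [← habs _ h10 h1η] at h1U
  rw [← habs _ h20 h2η] at h2U
  rcases le_total |θ₁| |θ₂| with hle | hle
  · exact h2U ((hmono _ _ (abs_pos.2 h10) hle h2η).1 h1U)
  · exact h2U ((hmono _ _ (abs_pos.2 h20) hle h1η).2 h1U)

end Avoiding

end PlaneColoring

namespace PlaneColoring

open Set Metric

variable {F U V : Set ℂ} {A d d' v w : ℂ} {r : ℝ}

namespace IsTwoColoring

/-- Near each of its points, `F` is a cone. -/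
theorem exists_cone (h : IsTwoColoring F U V) (hA : A ∈ F) :
    ∃ ε > 0, ∀ x : ℂ, ‖x‖ < ε → A + x ∈ F → ∀ s : ℝ, 0 ≤ s → ‖s • x‖ < ε → A + s • x ∈ F := by
  obtain ⟨L, hL, hL0, hLF⟩ := h.lines (‖A‖ + 1)
  have e1 : ∀ᶠ y in nhds A, ∀ l ∈ L, dot l.1 A ≠ l.2 → dot l.1 y ≠ l.2 := by
    rw [Filter.eventually_all_finite hL]
    intro l _
    by_cases hl : dot l.1 A = l.2
    · exact Filter.Eventually.of_forall fun y hne => absurd hl hne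
    · filter_upwards [(continuous_dot l.1).continuousAt.eventually_ne hl] with y hy _
      exact hy
  obtain ⟨ε₀, hε₀, he⟩ := Metric.eventually_nhds_iff.1 e1
  set ε := min ε₀ 1 with hε
  have hεp : 0 < ε := by positivity
  have hline : ∀ y : ℂ, ‖y - A‖ < ε → y ∈ F → ∃ l ∈ L, dot l.1 A = l.2 ∧ dot l.1 y = l.2 := by
    intro y hy hyF
    have hyn : ‖y‖ ≤ ‖A‖ + 1 := by
      have h1 := norm_add_le A (y - A)
      rw [add_sub_cancel] at h1
      have := hy.trans_le (min_le_right _ _)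
      linarith
    obtain ⟨l, hl, hly⟩ := hLF y hyF hyn
    refine ⟨l, hl, ?_, hly⟩
    by_contra hlA
    exact he (by rw [dist_eq_norm]; exact hy.trans_le (min_le_left _ _)) l hl hlA hly
  refine ⟨ε, hεp, ?_⟩
  intro x hx hxF s hs hsx
  by_cases hx0 : x = 0
  · simpa [hx0] using hA
  rcases hs.eq_or_lt with rfl | hs
  · simpa using hA
  have hxn := norm_pos_iff.2 hx0
  set M := ε / ‖x‖ with hM
  have hmem : ∀ s : ℝ, 0 < s → (s ∈ Ioo 0 M ↔ ‖s • x‖ < ε) := by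
    intro s hs
    rw [norm_smul, Real.norm_of_nonneg hs.le, ← lt_div_iff₀ hxn]
    simp [hs, hM]
  set u : Set ℝ := {s | s ∈ Ioo 0 M ∧ A + s • x ∈ F} with hu
  have hopen : IsOpen u := by
    rw [isOpen_iff_mem_nhds]
    rintro s ⟨hs, hsF⟩
    have hsx := (hmem s hs.1).1 hs
    set X := A + s • x with hX
    have e2 : ∀ᶠ y in nhds X, ∀ l ∈ L, dot l.1 X ≠ l.2 → dot l.1 y ≠ l.2 := by
      rw [Filter.eventually_all_finite hL]
      intro l _
      by_cases hl : dot l.1 X = l.2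
      · exact Filter.Eventually.of_forall fun y hne => absurd hl hne
      · filter_upwards [(continuous_dot l.1).continuousAt.eventually_ne hl] with y hy _
        exact hy
    have e3 : ∀ᶠ y in nhds X, ‖y - A‖ < ε :=
      (by fun_prop : Continuous fun y : ℂ => ‖y - A‖).continuousAt.eventually_lt
        continuousAt_const (by simpa [hX] using hsx)
    obtain ⟨δ, hδ, hflat⟩ := Metric.eventually_nhds_iff.1 (e2.and e3)
    have := (h.flat (n := Complex.I * x) (by simpa using hx0) hsF hδ ?_).1
    · have e4 : ∀ᶠ t in nhds s, A + t • x ∈ ball X δ :=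
        (by fun_prop : Continuous fun t : ℝ => A + t • x).continuousAt.eventually_mem
          (isOpen_ball.mem_nhds (by simpa [hX] using hδ))
      filter_upwards [e4, isOpen_Ioo.mem_nhds hs] with t ht1 ht2
      refine ⟨ht2, this _ ht1 ?_⟩
      have : dot (Complex.I * x) x = 0 := by simp [dot]; ring
      rw [hX, dot_add, dot_add, dot_smul, dot_smul, this, mul_zero, mul_zero]
    · intro y hy hyF
      obtain ⟨h1, h2⟩ := hflat hy
      obtain ⟨l, hl, hlA, hly⟩ := hline y h2 hyF
      have hlX : dot l.1 X = l.2 := by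
        by_contra hlX
        exact h1 l hl hlX hly
      have hlx : dot l.1 x = 0 := by
        rw [hX, dot_add, dot_smul, hlA] at hlX
        have := hs.1.ne'
        simpa [this] using hlX
      rw [← hlX] at hly
      have h5 := hL0 l hl
      clear_value X
      simp only [dot, Complex.mul_re, Complex.mul_im, Complex.I_re, Complex.I_im] at hly hlx ⊢
      have : l.1.re ≠ 0 ∨ l.1.im ≠ 0 := by
        by_contra! hh
        exact h5 (Complex.ext hh.1 hh.2)
      rcases this with hh | hh
      · apply mul_left_cancel₀ hh
        linear_combination (y.im - X.im) * hlx - x.im * hly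
      · apply mul_left_cancel₀ hh
        linear_combination x.re * hly + (X.re - y.re) * hlx
  have hsub : Ioo 0 M ⊆ u := by
    refine isPreconnected_Ioo.subset_of_closure_inter_subset hopen
      ⟨1, ?_, ?_, by simpa using hxF⟩ ?_
    · exact (hmem 1 one_pos).2 (by simpa using hx)
    · exact (hmem 1 one_pos).2 (by simpa using hx)
    · rintro t ⟨ht, ht'⟩
      refine ⟨ht', ?_⟩
      have hcl : IsClosed {t : ℝ | A + t • x ∈ F} := h.isClosed.preimage (by fun_prop)
      exact closure_minimal (fun t ht => ht.2) hcl ht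
  exact (hsub ((hmem s hs).2 hsx)).2

/-- Near one of its points, `F` is not contained in a single ray. -/
theorem not_subset_ray (h : IsTwoColoring F U V) (hA : A ∈ F) {ε : ℝ} (hε : 0 < ε) (hd : d ≠ 0) :
    ∃ x : ℂ, ‖x‖ < ε ∧ A + x ∈ F ∧ ∀ s : ℝ, 0 ≤ s → x ≠ s • d := by
  by_contra! hray
  set S : Set ℂ := {x | ‖x‖ < ε ∧ ∀ s : ℝ, 0 ≤ s → x ≠ s • d} with hS
  have hdn := norm_pos_iff.2 hd
  set η := ε / 2 / ‖d‖ with hη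
  have hηp : 0 < η := by positivity
  have hηd : ‖-(η • d)‖ < ε := by
    rw [norm_neg, norm_smul, Real.norm_of_nonneg hηp.le, hη, div_mul_cancel₀ _ hdn.ne']
    linarith
  have hp : -(η • d) ∈ S := by
    refine ⟨hηd, fun s hs heq => ?_⟩
    have : (s + η) • d = 0 := by rw [add_smul, ← heq]; ring
    rcases smul_eq_zero.1 this with h1 | h1
    · linarith
    · exact hd h1
  have hstar : StarConvex ℝ (-(η • d)) S := by
    intro x hx a b ha hb hab
    constructor
    · have := (convex_ball (0 : ℂ) ε) (x := -(η • d)) (by simpa using hηd) (y := x)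
        (by simpa using hx.1) ha hb hab
      simpa using this
    · intro s hs heq
      rcases hb.eq_or_lt with rfl | hb
      · have : a = 1 := by linarith
        subst this
        exact hp.2 s hs (by simpa using heq)
      · refine hx.2 ((s + a * η) / b) (by positivity) ?_
        have h1 : b • x = (s + a * η) • d := by
          rw [add_smul, mul_smul, ← heq, smul_neg]; ring
        rw [div_eq_inv_mul, mul_smul, ← h1, smul_smul, inv_mul_cancel₀ hb.ne', one_smul]
  have hpre : IsPreconnected ((fun x => A + x) '' S) :=
    (hstar.isPathConnected hp).isConnected.isPreconnected.image _ (by fun_prop)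
  have hmono := h.mono_of_preconnected hpre (by
    rintro _ ⟨x, hx, rfl⟩ hF
    obtain ⟨s, hs, hxs⟩ := hray x hx.1 hF
    exact hx.2 s hs hxs)
  have key : ∀ {U V : Set ℂ}, IsTwoColoring F U V → ¬ (fun x => A + x) '' S ⊆ U := by
    intro U V h hsub
    obtain ⟨y, hy, hyV⟩ := mem_closure_iff.1 (h.sub_right hA) _ isOpen_ball
      (mem_ball_self hε)
    have ho : IsOpen (ball A ε ∩ V) := isOpen_ball.inter h.isOpen_right
    have hev : ∀ᶠ t in nhds (0 : ℝ), y + t • (Complex.I * d) ∈ ball A ε ∩ V :=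
      (by fun_prop : Continuous fun t : ℝ => y + t • (Complex.I * d)).continuousAt.eventually_mem
        (ho.mem_nhds (by simpa using ⟨hy, hyV⟩))
    have hyS : y - A ∉ S := fun hyS =>
      h.notMem_both (hsub ⟨_, hyS, by simp⟩) hyV
    obtain ⟨η, hη, hev⟩ := Metric.eventually_nhds_iff.1 hev
    have h1 := hev (y := η / 2) (by
      rw [Real.dist_eq, sub_zero, abs_of_pos (by positivity)]; linarith)
    refine h.notMem_both (hsub ⟨y + (η / 2) • (Complex.I * d) - A, ⟨?_, ?_⟩, by simp⟩) h1.2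
    · rw [← dist_eq_norm]; exact h1.1
    · intro s hs heq
      apply hyS
      refine ⟨by rw [← dist_eq_norm]; exact hy, ?_⟩
      intro s' hs' heq'
      have h2 : (η / 2) • (Complex.I * d) = (s - s') • d := by
        rw [sub_smul, ← heq, ← heq']; ring
      have h3 : dot (Complex.I * d) ((η / 2) • (Complex.I * d)) = 0 := by
        rw [h2, dot_smul]; simp [dot]; right; ring
      rw [dot_smul] at h3
      have h4 := dot_self_pos (x := Complex.I * d) (by simpa using hd)
      have : 0 < η / 2 * dot (Complex.I * d) (Complex.I * d) := by positivity
      linarith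
  rcases hmono with hm | hm
  · exact key h hm
  · exact key h.symm hm

end IsTwoColoring

namespace Avoiding

/-- Near one of its points, `F` consists of two branches, which lie on different sides of any
switch direction. -/
theorem exists_branches (h : Avoiding F U V r) (hA : A ∈ F) (hv : v ∈ switch U V r A) :
    ∃ ε > 0, ∃ p m : ℂ, Dir F A p ∧ Dir F A m ∧ 0 < dot p v ∧ dot m v < 0 ∧
      ∀ x : ℂ, ‖x‖ < ε → A + x ∈ F → ∃ s : ℝ, 0 ≤ s ∧ (x = s • p ∨ x = s • m) := by
  obtain ⟨ε, hε, hcone⟩ := h.col.exists_cone hA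
  have hdir : ∀ x : ℂ, ‖x‖ < ε → A + x ∈ F → Dir F A x := by
    intro x hx hxF t ht
    refine hcone x hx hxF t ht.1 ?_
    rw [norm_smul, Real.norm_of_nonneg ht.1]
    exact (mul_le_of_le_one_left (norm_nonneg _) ht.2).trans_lt hx
  have key : ∀ v ∈ switch U V r A, ∃ x : ℂ, ‖x‖ < ε ∧ A + x ∈ F ∧ 0 < dot x v := by
    intro v hv
    by_contra! hneg
    have hneg' : ∀ x : ℂ, ‖x‖ < ε → A + x ∈ F → x ≠ 0 → dot x v < 0 := fun x hx hxF hx0 =>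
      lt_of_le_of_ne (hneg x hx hxF) (h.dot_ne_zero hv (hdir x hx hxF) hx0)
    obtain ⟨x₀, hx1, hx2, hx3⟩ := h.col.not_subset_ray hA hε one_ne_zero
    have hx0 : x₀ ≠ 0 := by rintro rfl; exact hx3 0 le_rfl (by simp)
    have hn0 := hneg' x₀ hx1 hx2 hx0
    obtain ⟨x, hy1, hy2, hy3⟩ := h.col.not_subset_ray hA hε hx0
    have hy0 : x ≠ 0 := by rintro rfl; exact hy3 0 le_rfl (by simp)
    have hny := hneg' x hy1 hy2 hy0
    refine hy3 (dot x v / dot x₀ v) (div_nonneg_of_nonpos hny.le hn0.le) ?_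
    rw [div_eq_inv_mul, mul_smul, ← h.parallel_of_neg hv (hdir x₀ hx1 hx2) (hdir x hy1 hy2) hn0 hny,
      smul_smul, inv_mul_cancel₀ hn0.ne, one_smul]
  obtain ⟨p, hp1, hp2, hp3⟩ := key v hv
  obtain ⟨m, hm1, hm2, hm3⟩ := key (-v) (h.neg_mem_switch hA hv)
  rw [dot_neg, neg_pos] at hm3
  refine ⟨ε, hε, p, m, hdir p hp1 hp2, hdir m hm1 hm2, hp3, hm3, ?_⟩
  intro x hx hxF
  have hxd := hdir x hx hxF
  rcases lt_trichotomy (dot x v) 0 with hlt | heq | hgt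
  · refine ⟨dot x v / dot m v, div_nonneg_of_nonpos hlt.le hm3.le, Or.inr ?_⟩
    rw [div_eq_inv_mul, mul_smul, ← h.parallel_of_neg hv (hdir m hm1 hm2) hxd hm3 hlt,
      smul_smul, inv_mul_cancel₀ hm3.ne, one_smul]
  · have : x = 0 := by
      by_contra hx0
      exact h.dot_ne_zero hv hxd hx0 heq
    exact ⟨0, le_rfl, Or.inl (by simpa using this)⟩
  · refine ⟨dot x v / dot p v, by positivity, Or.inl ?_⟩
    rw [div_eq_inv_mul, mul_smul, ← h.parallel_of_pos hv (hdir p hp1 hp2) hxd hp3 hgt,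
      smul_smul, inv_mul_cancel₀ hp3.ne', one_smul]

/-- Branches separated by one switch direction are separated by every switch direction. -/
theorem opposite_sides (h : Avoiding F U V r) (hd : Dir F A d) (hd' : Dir F A d')
    (hdv : 0 < dot d v) (hdv' : dot d' v < 0) (hw : w ∈ switch U V r A) :
    (0 < dot d w ∧ dot d' w < 0) ∨ (dot d w < 0 ∧ 0 < dot d' w) := by
  have hd0 : d ≠ 0 := by rintro rfl; simp [dot] at hdv
  have hd0' : d' ≠ 0 := by rintro rfl; simp [dot] at hdv'
  rcases lt_or_gt_of_ne (h.dot_ne_zero hw hd hd0) with h1 | h1 <;>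
    rcases lt_or_gt_of_ne (h.dot_ne_zero hw hd' hd0') with h2 | h2
  · have := congrArg (dot v) (h.parallel_of_neg hw hd hd' h1 h2)
    rw [dot_smul, dot_smul, dot_comm v, dot_comm v] at this
    nlinarith [mul_pos_of_neg_of_neg h1 hdv', mul_pos_of_neg_of_neg h2 (neg_neg_of_pos hdv)]
  · exact Or.inr ⟨h1, h2⟩
  · exact Or.inl ⟨h1, h2⟩
  · have := congrArg (dot v) (h.parallel_of_pos hw hd hd' h1 h2)
    rw [dot_smul, dot_smul, dot_comm v, dot_comm v] at this
    nlinarith [mul_pos h2 hdv, mul_neg_of_pos_of_neg h1 hdv']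

end Avoiding

end PlaneColoring

namespace PlaneColoring

open Set Metric

variable {F U V : Set ℂ} {A d d' v w x y : ℂ} {r : ℝ}

/-- A locally constant predicate on `F` is constant on preconnected subsets of `F`. -/
theorem forall_of_eventually_iff {F S : Set ℂ} {P : ℂ → Prop}
    (hP : ∀ x ∈ F, ∀ᶠ y in nhds x, y ∈ F → (P x ↔ P y)) (hS : IsPreconnected S) (hSF : S ⊆ F)
    (hx : x ∈ S) (hPx : P x) : ∀ y ∈ S, P y := by
  have h := isPreconnected_iff_subset_of_disjoint.1 hS (interior {y | y ∈ F → P y})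
    (interior {y | y ∈ F → ¬ P y}) isOpen_interior isOpen_interior ?_ ?_
  · intro y hy
    rcases h with h | h
    · exact interior_subset (h hy) (hSF hy)
    · exact absurd hPx (interior_subset (h hx) (hSF hx))
  · intro y hy
    by_cases hPy : P y
    · left
      rw [mem_interior_iff_mem_nhds]
      filter_upwards [hP y (hSF hy)] with z hz hzF
      exact (hz hzF).1 hPy
    · right
      rw [mem_interior_iff_mem_nhds]
      filter_upwards [hP y (hSF hy)] with z hz hzF hPz
      exact hPy ((hz hzF).2 hPz)
  · rw [eq_empty_iff_forall_notMem]
    rintro y ⟨hy, hy1, hy2⟩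
    exact interior_subset hy2 (hSF hy) (interior_subset hy1 (hSF hy))

theorem dot_add_left (x y z : ℂ) : dot (x + y) z = dot x z + dot y z := by
  simp [dot]; ring

theorem dot_neg_left (x y : ℂ) : dot (-x) y = -dot x y := by simp [dot]; ring

@[fun_prop]
theorem continuous_dot_left (x : ℂ) : Continuous fun y => dot y x := by
  unfold dot; fun_prop

/-- The closed cone of vectors making an angle of at most `30` degrees with `v`. -/
def cone (v : ℂ) : Set ℂ := {x | 0 ≤ dot x (om * v) ∧ 0 ≤ dot x ((1 - om) * v)}

/-- The open cone of vectors making an angle less than `30` degrees with `v`. -/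
def openCone (v : ℂ) : Set ℂ := {x | 0 < dot x (om * v) ∧ 0 < dot x ((1 - om) * v)}

theorem openCone_subset_cone (v : ℂ) : openCone v ⊆ cone v := fun _ h => ⟨h.1.le, h.2.le⟩

theorem zero_mem_cone (v : ℂ) : 0 ∈ cone v := by simp [cone, dot]

theorem cone_add (hx : x ∈ cone v) (hy : y ∈ cone v) : x + y ∈ cone v := by
  constructor <;> rw [dot_add_left]
  · exact add_nonneg hx.1 hy.1
  · exact add_nonneg hx.2 hy.2

theorem cone_smul (hx : x ∈ cone v) {s : ℝ} (hs : 0 ≤ s) : s • x ∈ cone v := by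
  constructor <;> rw [dot_smul_left]
  · exact mul_nonneg hs hx.1
  · exact mul_nonneg hs hx.2

theorem openCone_smul (hx : x ∈ openCone v) {s : ℝ} (hs : 0 < s) : s • x ∈ openCone v := by
  constructor <;> rw [dot_smul_left]
  · exact mul_pos hs hx.1
  · exact mul_pos hs hx.2

theorem isClosed_cone (v : ℂ) : IsClosed (cone v) :=
  (isClosed_le continuous_const (continuous_dot_left _)).inter
    (isClosed_le continuous_const (continuous_dot_left _))

theorem mem_cone_neg : x ∈ cone (-v) ↔ -x ∈ cone v := by
  simp [cone, dot_neg, dot_neg_left]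

theorem mem_openCone_neg : x ∈ openCone (-v) ↔ -x ∈ openCone v := by
  simp [openCone, dot_neg, dot_neg_left]

theorem dot_nonneg_of_mem_cone (hx : x ∈ cone v) : 0 ≤ dot x v := by
  rw [← dot_om_add]; exact add_nonneg hx.1 hx.2

theorem dot_pos_of_mem_openCone (hx : x ∈ openCone v) : 0 < dot x v := by
  rw [← dot_om_add]; exact add_pos hx.1 hx.2

theorem norm_mul_norm_le_of_mem_cone (hx : x ∈ cone v) : ‖x‖ * ‖v‖ ≤ 2 * dot x v := by
  have h0 := dot_nonneg_of_mem_cone hx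
  apply le_of_sq_le_sq _ (by positivity)
  have h1 := mul_nonneg hx.1 hx.2
  have h2 : dot x (om * v) * dot x ((1 - om) * v) =
      dot x v ^ 2 / 4 - 3 / 4 * (x.im * v.re - x.re * v.im) ^ 2 := by
    simp [dot, om]
    linear_combination -(x.im * v.re - x.re * v.im) ^ 2 / 4 * sqrt_three_sq
  have h3 : (‖x‖ * ‖v‖) ^ 2 = dot x v ^ 2 + (x.im * v.re - x.re * v.im) ^ 2 := by
    rw [mul_pow, ← dot_self, ← dot_self]; simp only [dot]; ring
  nlinarith [sq_nonneg (dot x v)]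

theorem dot_pos_of_mem_cone (hx : x ∈ cone v) (hx0 : x ≠ 0) (hv0 : v ≠ 0) : 0 < dot x v := by
  have h1 := norm_mul_norm_le_of_mem_cone hx
  have : 0 < ‖x‖ * ‖v‖ := mul_pos (norm_pos_iff.2 hx0) (norm_pos_iff.2 hv0)
  linarith

theorem IsTwoColoring.eventually_dir (h : IsTwoColoring F U V) (hA : A ∈ F) :
    ∀ᶠ y in nhds A, y ∈ F → Dir F A (y - A) := by
  obtain ⟨ε, hε, hcone⟩ := h.exists_cone hA
  filter_upwards [ball_mem_nhds A hε] with y hy hyF t ht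
  rw [mem_ball, dist_eq_norm] at hy
  refine hcone _ hy (by simpa using hyF) t ht.1 ?_
  rw [norm_smul, Real.norm_of_nonneg ht.1]
  exact (mul_le_of_le_one_left (norm_nonneg _) ht.2).trans_lt hy

/-- The points of `F` at which `v` is a switch direction and which have a branch in the open
cone around `v`. -/
def along (F U V : Set ℂ) (r : ℝ) (v : ℂ) : Set ℂ :=
  {A | v ∈ switch U V r A ∧ ∃ d ∈ openCone v, Dir F A d}

theorem along_subset : along F U V r v ⊆ F := fun _ ⟨_, _, _, hd⟩ => hd.left_mem

namespace Avoiding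

theorem eventually_switch_eq (h : Avoiding F U V r) (hA : A ∈ F) :
    ∀ᶠ y in nhds A, y ∈ F → switch U V r y = switch U V r A := by
  filter_upwards [h.col.eventually_dir hA] with y hy hyF
  rw [← h.switch_eq (hy hyF), add_sub_cancel]

theorem switch_eq_of_preconnected (h : Avoiding F U V r) {S : Set ℂ} (hS : IsPreconnected S)
    (hSF : S ⊆ F) (hx : x ∈ S) (hy : y ∈ S) : switch U V r y = switch U V r x := by
  refine forall_of_eventually_iff (P := fun y => switch U V r y = switch U V r x) ?_ hS hSF hx rfl
    y hy
  intro z hz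
  filter_upwards [h.eventually_switch_eq hz] with y hy hyF
  rw [hy hyF]

theorem mem_openCone_of_along (h : Avoiding F U V r) (hA : A ∈ along F U V r v)
    (hd : Dir F A d) (hdv : 0 < dot d v) : d ∈ openCone v := by
  obtain ⟨hv, e, he, hde⟩ := hA
  have hev := dot_pos_of_mem_openCone he
  have h1 := h.parallel_of_pos hv hd hde hdv hev
  have : d = (dot d v / dot e v) • e := by
    rw [div_eq_inv_mul, mul_smul, h1, smul_smul, inv_mul_cancel₀ hev.ne', one_smul]
  rw [this]
  exact openCone_smul he (by positivity)

theorem along_neg (h : Avoiding F U V r) (hA : A ∈ along F U V r v) : A ∈ along F U V r (-v) := by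
  have hAF := along_subset hA
  obtain ⟨hv, e, he, hde⟩ := hA
  obtain ⟨ε, hε, p, m, hp, hm, hpv, hmv, -⟩ := h.exists_branches hAF hv
  have hev := dot_pos_of_mem_openCone he
  refine ⟨h.neg_mem_switch hAF hv, m, ?_, hm⟩
  have h1 := h.opposite_sides hde hm hev hmv (h.om_mul_mem_switch hAF hv)
  have h2 := h.opposite_sides hde hm hev hmv (h.one_sub_om_mul_mem_switch hAF hv)
  have h3 := he.1
  have h4 := he.2
  rw [mem_openCone_neg]
  constructor <;> rw [dot_neg_left]
  · rcases h1 with h1 | h1 <;> linarith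
  · rcases h2 with h2 | h2 <;> linarith

theorem exists_branches_along (h : Avoiding F U V r) (hA : A ∈ along F U V r v) :
    ∃ ε > 0, ∃ p ∈ openCone v, ∃ m ∈ openCone (-v), Dir F A p ∧ Dir F A m ∧
      ∀ x : ℂ, ‖x‖ < ε → A + x ∈ F → ∃ s : ℝ, 0 ≤ s ∧ (x = s • p ∨ x = s • m) := by
  have hAF := along_subset hA
  obtain ⟨ε, hε, p, m, hp, hm, hpv, hmv, hc⟩ := h.exists_branches hAF hA.1
  exact ⟨ε, hε, p, h.mem_openCone_of_along hA hp hpv, m,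
    h.mem_openCone_of_along (h.along_neg hA) hm (by rw [dot_neg]; linarith), hp, hm, hc⟩

theorem along_of_dir (h : Avoiding F U V r) (hA : A ∈ along F U V r v) (hd : Dir F A d) :
    A + d ∈ along F U V r v := by
  by_cases hd0 : d = 0
  · simpa [hd0] using hA
  have key : ∀ v, A ∈ along F U V r v → 0 < dot d v → A + d ∈ along F U V r (-v) := by
    intro v hA hdv
    refine ⟨?_, -d, ?_, hd.reverse⟩
    · rw [h.switch_eq hd]
      exact h.neg_mem_switch hd.left_mem hA.1
    · rw [mem_openCone_neg, neg_neg]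
      exact h.mem_openCone_of_along hA hd hdv
  rcases lt_or_gt_of_ne (h.dot_ne_zero hA.1 hd hd0) with hlt | hgt
  · have := key (-v) (h.along_neg hA) (by rw [dot_neg]; linarith)
    rwa [neg_neg] at this
  · have := h.along_neg (key v hA hgt)
    rwa [neg_neg] at this

theorem eventually_along_iff (h : Avoiding F U V r) (hA : A ∈ F) :
    ∀ᶠ y in nhds A, y ∈ F → (A ∈ along F U V r v ↔ y ∈ along F U V r v) := by
  filter_upwards [h.col.eventually_dir hA] with y hy hyF
  have hd := hy hyF
  constructor
  · intro hA
    simpa using h.along_of_dir hA hd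
  · intro hy
    have := h.along_of_dir (A := y) (d := -(y - A)) hy (by simpa using hd.reverse)
    simpa using this

/-- One of the three switch directions obtained from `w` is a direction of `F` at `A`. -/
theorem mem_along_or (h : Avoiding F U V r) (hA : A ∈ F) (hw : w ∈ switch U V r A) :
    A ∈ along F U V r w ∨ A ∈ along F U V r (om * w) ∨ A ∈ along F U V r (om * (om * w)) := by
  have hw1 := h.om_mul_mem_switch hA hw
  have hw2 := h.om_mul_mem_switch hA hw1
  obtain ⟨ε, hε, p, m, hp, hm, hpw, hmw, -⟩ := h.exists_branches hA hw
  have e1 : ∀ d, dot d ((1 - om) * w) = -dot d (om * (om * w)) := fun d => by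
    rw [← dot_neg]; congr 1; linear_combination w * om_mul_om
  have e2 : ∀ d, dot d ((1 - om) * (om * w)) = dot d w := fun d => by
    congr 1; linear_combination -w * om_mul_om
  have e3 : ∀ d, dot d (om * (om * (om * w))) = -dot d w := fun d => by
    rw [← dot_neg]; congr 1; linear_combination (w + om * w) * om_mul_om
  have e4 : ∀ d, dot d ((1 - om) * (om * (om * w))) = dot d (om * w) := fun d => by
    congr 1; linear_combination -om * w * om_mul_om
  have mk : ∀ {u d : ℂ}, u ∈ switch U V r A → Dir F A d → 0 < dot d (om * u) →
      0 < dot d ((1 - om) * u) → A ∈ along F U V r u := fun hu hd h1 h2 => ⟨hu, _, ⟨h1, h2⟩, hd⟩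
  rcases h.opposite_sides hp hm hpw hmw hw1 with ⟨h1, h1'⟩ | ⟨h1, h1'⟩
  · rcases h.opposite_sides hp hm hpw hmw hw2 with ⟨h2, h2'⟩ | ⟨h2, h2'⟩
    · exact Or.inr (Or.inl (mk hw1 hp h2 (by rwa [e2])))
    · exact Or.inl (mk hw hp h1 (by rw [e1]; linarith))
  · exact Or.inr (Or.inr (mk hw2 hm (by rw [e3]; linarith) (by rwa [e4])))

end Avoiding

end PlaneColoring

namespace PlaneColoring

open Set Metric

variable {F U V K M : Set ℂ} {A B v x : ℂ} {r : ℝ}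

/-- Any two points of `K` differ by a vector of the closed double cone around `v`. -/
def IsConeChain (v : ℂ) (K : Set ℂ) : Prop := ∀ X ∈ K, ∀ Y ∈ K, Y - X ∈ cone v ∨ X - Y ∈ cone v

theorem IsConeChain.neg (h : IsConeChain v K) : IsConeChain (-v) K := by
  intro X hX Y hY
  rw [mem_cone_neg, mem_cone_neg, neg_sub, neg_sub]
  exact (h X hX Y hY).symm

theorem IsConeChain.closure (h : IsConeChain v K) : IsConeChain v (closure K) := by
  have hcl : IsClosed {p : ℂ × ℂ | p.2 - p.1 ∈ cone v ∨ p.1 - p.2 ∈ cone v} :=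
    ((isClosed_cone v).preimage (f := fun p : ℂ × ℂ => p.2 - p.1) (by fun_prop)).union
      ((isClosed_cone v).preimage (f := fun p : ℂ × ℂ => p.1 - p.2) (by fun_prop))
  have hsub : K ×ˢ K ⊆ {p : ℂ × ℂ | p.2 - p.1 ∈ cone v ∨ p.1 - p.2 ∈ cone v} :=
    fun p hp => h _ hp.1 _ hp.2
  intro X hX Y hY
  have := closure_minimal hsub hcl
  rw [closure_prod_eq] at this
  exact this (mk_mem_prod hX hY)

/-- A connected component of `F` that is a chain for the double cone around `v`. -/
structure Strand (F U V : Set ℂ) (r : ℝ) (v : ℂ) (K : Set ℂ) : Prop where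
  sub : K ⊆ along F U V r v
  preconnected : IsPreconnected K
  closed : IsClosed K
  isolated : ∀ B ∈ K, ∀ᶠ y in nhds B, y ∈ F → y ∈ K
  chain : IsConeChain v K

theorem dir_preconnected (d : ℂ) (A : ℂ) :
    IsPreconnected ((fun t : ℝ => A + t • d) '' Icc 0 1) :=
  isPreconnected_Icc.image _ (by fun_prop)

namespace Avoiding

theorem ne_zero_of_along (h : Avoiding F U V r) (hA : A ∈ along F U V r v) : v ≠ 0 := by
  rintro rfl
  have := norm_of_mem_switch hA.1
  have := h.pos
  simp_all

theorem along_of_preconnected (h : Avoiding F U V r) {S : Set ℂ} (hS : IsPreconnected S)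
    (hSF : S ⊆ F) (hx : x ∈ S) (hxv : x ∈ along F U V r v) : S ⊆ along F U V r v :=
  forall_of_eventually_iff (P := fun y => y ∈ along F U V r v)
    (fun _ hz => h.eventually_along_iff hz) hS hSF hx hxv

theorem branch_mem_of_maximal (h : Avoiding F U V r) (hM : M ⊆ along F U V r v)
    (hMp : IsPreconnected M) (hMc : IsConeChain v M)
    (hmax : ∀ M', M' ⊆ along F U V r v → IsPreconnected M' → IsConeChain v M' → M ⊆ M' → M' ⊆ M)
    (hB : B ∈ M) {ε : ℝ} {p m : ℂ} (hε : 0 < ε) (hp : p ∈ openCone v) (hm : m ∈ openCone (-v))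
    (hpF : Dir F B p)
    (hloc : ∀ x : ℂ, ‖x‖ < ε → B + x ∈ F → ∃ s : ℝ, 0 ≤ s ∧ (x = s • p ∨ x = s • m)) :
    ∃ η > (0 : ℝ), ∀ s ∈ Icc (0 : ℝ) η, B + s • p ∈ M := by
  have hv0 := h.ne_zero_of_along (hM hB)
  have hpv := dot_pos_of_mem_openCone hp
  have hmv := dot_pos_of_mem_openCone hm
  rw [dot_neg] at hmv
  by_cases hY : ∃ Y ∈ M, Y - B ∈ cone v ∧ Y ≠ B
  · obtain ⟨Y, hYM, hYB, hne⟩ := hY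
    have hlt : 0 < dot (Y - B) v := dot_pos_of_mem_cone hYB (sub_ne_zero.2 hne) hv0
    have hvn := norm_pos_iff.2 hv0
    refine ⟨min (dot (Y - B) v / dot p v) (ε * ‖v‖ / (4 * dot p v)), by positivity, ?_⟩
    rintro s ⟨hs0, hs⟩
    have hs1 := hs.trans (min_le_left _ _)
    have hs2 := hs.trans (min_le_right _ _)
    rw [le_div_iff₀ hpv] at hs1
    rw [le_div_iff₀ (by positivity)] at hs2
    have hcn : ContinuousOn (fun z => dot (z - B) v) M := by
      have : Continuous (fun z => dot (z - B) v) := by unfold dot; fun_prop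
      exact this.continuousOn
    obtain ⟨Z, hZ, hZv⟩ := hMp.intermediate_value hB hYM hcn
      (show s * dot p v ∈ Icc _ _ from ⟨by simpa [dot] using mul_nonneg hs0 hpv.le, hs1⟩)
    simp only at hZv
    have hZc : Z - B ∈ cone v := by
      rcases hMc B hB Z hZ with hc | hc
      · exact hc
      · have h1 := dot_nonneg_of_mem_cone hc
        by_cases hZB : Z = B
        · rw [hZB, sub_self]; exact zero_mem_cone v
        · have h2 := dot_pos_of_mem_cone hc (sub_ne_zero.2 (Ne.symm hZB)) hv0
          rw [← neg_sub, dot_neg_left, hZv] at h2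
          nlinarith
    have hZn : ‖Z - B‖ < ε := by
      have h1 := norm_mul_norm_le_of_mem_cone hZc
      rw [hZv] at h1
      have : 0 < ε * ‖v‖ := by positivity
      by_contra! hle
      nlinarith
    obtain ⟨t, ht, hx | hx⟩ := hloc (Z - B) hZn (by simpa using along_subset (hM hZ))
    · rw [hx, dot_smul_left] at hZv
      have : t = s := mul_right_cancel₀ hpv.ne' hZv
      rw [← this, ← hx, add_sub_cancel]
      exact hZ
    · rw [hx, dot_smul_left] at hZv
      have h1 : 0 ≤ s * dot p v := by positivity
      have h2 : t = 0 := by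
        by_contra h0
        have := lt_of_le_of_ne ht (Ne.symm h0)
        nlinarith
      rw [h2, zero_mul] at hZv
      have : s = 0 := by
        rcases mul_eq_zero.1 hZv.symm with h3 | h3
        · exact h3
        · exact absurd h3 hpv.ne'
      simpa [this] using hB
  · push Not at hY
    have hY' : ∀ Y ∈ M, B - Y ∈ cone v := by
      intro Y hYM
      rcases hMc B hB Y hYM with hc | hc
      · rw [hY Y hYM hc, sub_self]; exact zero_mem_cone v
      · exact hc
    set T := (fun t : ℝ => B + t • p) '' Icc 0 1 with hT
    have hTB : B ∈ T := ⟨0, by simp, by simp⟩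
    have hTF : T ⊆ F := by
      rintro _ ⟨t, ht, rfl⟩
      exact hpF t ht
    refine ⟨1, one_pos, fun s hs => ?_⟩
    refine hmax (M ∪ T) (union_subset hM ?_) (hMp.union B hB hTB (dir_preconnected p B)) ?_
      subset_union_left (Or.inr ⟨s, hs, rfl⟩)
    · exact h.along_of_preconnected (dir_preconnected p B) hTF hTB (hM hB)
    · have hMT : ∀ X ∈ M, ∀ Y ∈ T, Y - X ∈ cone v := by
        rintro X hX _ ⟨t, ht, rfl⟩
        have := cone_add (hY' X hX) (cone_smul (openCone_subset_cone v hp) ht.1)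
        convert this using 1
        ring
      have hTT : ∀ a b : ℝ, a ≤ b → (B + b • p) - (B + a • p) ∈ cone v := by
        intro a b hab
        have := cone_smul (openCone_subset_cone v hp) (sub_nonneg.2 hab)
        convert this using 1
        rw [sub_smul]; ring
      rintro X (hX | hX) Y (hY | hY)
      · exact hMc X hX Y hY
      · exact Or.inl (hMT X hX Y hY)
      · exact Or.inr (hMT Y hY X hX)
      · obtain ⟨a, -, rfl⟩ := hX
        obtain ⟨b, -, rfl⟩ := hY
        exact (le_total a b).imp (hTT a b) (hTT b a)

theorem along_neg_iff (h : Avoiding F U V r) : along F U V r (-v) = along F U V r v :=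
  Subset.antisymm (fun _ hA => by simpa using h.along_neg hA) fun _ hA => h.along_neg hA

theorem exists_strand (h : Avoiding F U V r) (hA : A ∈ along F U V r v) :
    ∃ K, A ∈ K ∧ Strand F U V r v K := by
  obtain ⟨M, hAM, hM⟩ := zorn_subset_nonempty
    {M : Set ℂ | M ⊆ along F U V r v ∧ A ∈ M ∧ IsPreconnected M ∧ IsConeChain v M} (by
      intro c hc hcc hcn
      refine ⟨⋃₀ c, ⟨sUnion_subset fun s hs => (hc hs).1, ?_, ?_, ?_⟩,
        fun s hs => subset_sUnion_of_mem hs⟩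
      · obtain ⟨s, hs⟩ := hcn
        exact ⟨s, hs, (hc hs).2.1⟩
      · exact isPreconnected_sUnion A c (fun s hs => (hc hs).2.1) fun s hs => (hc hs).2.2.1
      · rintro X ⟨s, hs, hX⟩ Y ⟨t, ht, hY⟩
        rcases hcc.total hs ht with hst | hst
        · exact (hc ht).2.2.2 X (hst hX) Y hY
        · exact (hc hs).2.2.2 X hX Y (hst hY)) {A}
    ⟨by simpa using hA, rfl, isPreconnected_singleton, by
      rintro X rfl Y rfl; left; rw [sub_self]; exact zero_mem_cone v⟩
  rw [singleton_subset_iff] at hAM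
  obtain ⟨⟨hMG, -, hMp, hMc⟩, hmax'⟩ := hM
  have hmax : ∀ M', M' ⊆ along F U V r v → IsPreconnected M' → IsConeChain v M' → M ⊆ M' →
      M' ⊆ M := fun M' h1 h2 h3 h4 => hmax' ⟨h1, h4 hAM, h2, h3⟩ h4
  refine ⟨M, hAM, hMG, hMp, ?_, ?_, hMc⟩
  · rw [← closure_subset_iff_isClosed]
    refine hmax _ ?_ hMp.closure hMc.closure subset_closure
    exact h.along_of_preconnected hMp.closure
      (closure_minimal (hMG.trans along_subset) h.col.isClosed) (subset_closure hAM) hA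
  · intro B hB
    obtain ⟨ε, hε, p, hp, m, hm, hpF, hmF, hloc⟩ := h.exists_branches_along (hMG hB)
    obtain ⟨η, hη, hpM⟩ := h.branch_mem_of_maximal hMG hMp hMc hmax hB hε hp hm hpF hloc
    obtain ⟨η', hη', hmM⟩ := h.branch_mem_of_maximal (v := -v) (by rwa [h.along_neg_iff]) hMp
      hMc.neg (by
        intro M' h1 h2 h3 h4
        rw [h.along_neg_iff] at h1
        exact hmax M' h1 h2 (by simpa using h3.neg) h4) hB hε hm (by simpa using hp) hmF
      (fun x hx hxF => by
        obtain ⟨s, hs, hh⟩ := hloc x hx hxF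
        exact ⟨s, hs, hh.symm⟩)
    have hp0 : 0 < ‖p‖ := norm_pos_iff.2 (by
      rintro rfl; have := hp.1; simp [dot] at this)
    have hm0 : 0 < ‖m‖ := norm_pos_iff.2 (by
      rintro rfl; have := hm.1; simp [dot] at this)
    have hδ : 0 < min ε (min (η * ‖p‖) (η' * ‖m‖)) := by positivity
    filter_upwards [ball_mem_nhds B hδ] with y hy hyF
    rw [mem_ball, dist_eq_norm, lt_min_iff, lt_min_iff] at hy
    obtain ⟨s, hs, hx | hx⟩ := hloc (y - B) hy.1 (by simpa using hyF)
    · have h1 := hy.2.1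
      rw [hx, norm_smul, Real.norm_of_nonneg hs, mul_lt_mul_iff_left₀ hp0] at h1
      have := hpM s ⟨hs, h1.le⟩
      rwa [← hx, add_sub_cancel] at this
    · have h1 := hy.2.2
      rw [hx, norm_smul, Real.norm_of_nonneg hs, mul_lt_mul_iff_left₀ hm0] at h1
      have := hmM s ⟨hs, h1.le⟩
      rwa [← hx, add_sub_cancel] at this

end Avoiding

end PlaneColoring

namespace PlaneColoring

open Set Metric

variable {F U V K K' S : Set ℂ} {A B d v w u x y p m : ℂ} {r : ℝ}

/-- A nonempty set of this kind is a connected component of `F`, open and closed in `F`. -/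
structure IsPiece (F K : Set ℂ) : Prop where
  sub : K ⊆ F
  preconnected : IsPreconnected K
  closed : IsClosed K
  isolated : ∀ B ∈ K, ∀ᶠ y in nhds B, y ∈ F → y ∈ K

theorem Strand.isPiece (h : Strand F U V r v K) : IsPiece F K :=
  ⟨h.sub.trans along_subset, h.preconnected, h.closed, h.isolated⟩

theorem IsPiece.subset_of_preconnected (h : IsPiece F K) (hS : IsPreconnected S) (hSF : S ⊆ F)
    (hxS : x ∈ S) (hxK : x ∈ K) : S ⊆ K := by
  refine forall_of_eventually_iff (P := fun y => y ∈ K) ?_ hS hSF hxS hxK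
  intro z _
  by_cases hz : z ∈ K
  · filter_upwards [h.isolated z hz] with y hy hyF
    exact ⟨fun _ => hy hyF, fun _ => hz⟩
  · filter_upwards [h.closed.isOpen_compl.mem_nhds hz] with y hy _
    exact ⟨fun h => absurd h hz, fun h => absurd h hy⟩

theorem IsPiece.eq (h : IsPiece F K) (h' : IsPiece F K') (hx : x ∈ K) (hx' : x ∈ K') : K = K' :=
  Subset.antisymm (h'.subset_of_preconnected h.preconnected h.sub hx hx')
    (h.subset_of_preconnected h'.preconnected h'.sub hx' hx)

theorem IsPiece.add_smul_mem (h : IsPiece F K) (hA : A ∈ K) (hd : Dir F A d) {t : ℝ}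
    (ht : t ∈ Icc (0 : ℝ) 1) : A + t • d ∈ K := by
  refine h.subset_of_preconnected (dir_preconnected d A) ?_ (x := A) ⟨0, by simp, by simp⟩ hA
    ⟨t, ht, rfl⟩
  rintro _ ⟨s, hs, rfl⟩
  exact hd s hs

namespace Avoiding

theorem eventually_mem_of_dirs (h : Avoiding F U V r) (hp : Dir F A p) (hm : Dir F A m)
    (hpv : 0 < dot p v) (hmv : dot m v < 0) :
    ∀ᶠ y in nhds A, y ∈ F → ∃ t ∈ Icc (0 : ℝ) 1, y = A + t • p ∨ y = A + t • m := by
  have hA := hp.left_mem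
  have hp0 : p ≠ 0 := by rintro rfl; simp [dot] at hpv
  have hm0 : m ≠ 0 := by rintro rfl; simp [dot] at hmv
  obtain ⟨u, hu⟩ := h.switch_nonempty hA
  obtain ⟨ε, hε, p', m', hp', hm', hpu', hmu', hloc⟩ := h.exists_branches hA hu
  have small : ∀ {e e' : ℂ}, e ≠ 0 → (∃ c : ℝ, 0 < c ∧ e' = c • e) →
      ∃ δ > 0, ∀ s : ℝ, 0 ≤ s → ‖s • e'‖ < δ → ∃ t ∈ Icc (0 : ℝ) 1, s • e' = t • e := by
    rintro e e' he ⟨c, hc, rfl⟩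
    refine ⟨‖e‖, norm_pos_iff.2 he, fun s hs hlt => ⟨s * c, ⟨by positivity, ?_⟩, smul_smul _ _ _⟩⟩
    rw [smul_smul, norm_smul, Real.norm_of_nonneg (by positivity)] at hlt
    by_contra! hle
    nlinarith [norm_pos_iff.2 he]
  have pos : ∀ {a b c : ℂ} {s t : ℝ}, 0 < s * t → s • a = t • b → ∃ c : ℝ, 0 < c ∧ a = c • b := by
    intro a b c s t hst hab
    have hs : s ≠ 0 := by rintro rfl; simp at hst
    refine ⟨t / s, ?_, ?_⟩
    · rw [show t / s = s * t / s ^ 2 by field_simp]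
      positivity
    · rw [div_eq_inv_mul, mul_smul, ← hab, smul_smul, inv_mul_cancel₀ hs, one_smul]
  have main : ∀ {a b : ℂ}, a ≠ 0 → b ≠ 0 → (∃ c : ℝ, 0 < c ∧ p' = c • a) →
      (∃ c : ℝ, 0 < c ∧ m' = c • b) →
      ∀ᶠ y in nhds A, y ∈ F → ∃ t ∈ Icc (0 : ℝ) 1, y = A + t • a ∨ y = A + t • b := by
    intro a b ha hb hpa hmb
    obtain ⟨δ, hδ, h1⟩ := small ha hpa
    obtain ⟨δ', hδ', h2⟩ := small hb hmb
    have : 0 < min ε (min δ δ') := by positivity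
    filter_upwards [ball_mem_nhds A this] with y hy hyF
    rw [mem_ball, dist_eq_norm, lt_min_iff, lt_min_iff] at hy
    obtain ⟨s, hs, hx | hx⟩ := hloc (y - A) hy.1 (by simpa using hyF)
    · obtain ⟨t, ht, hst⟩ := h1 s hs (hx ▸ hy.2.1)
      exact ⟨t, ht, Or.inl (by rw [← hst, ← hx]; ring)⟩
    · obtain ⟨t, ht, hst⟩ := h2 s hs (hx ▸ hy.2.2)
      exact ⟨t, ht, Or.inr (by rw [← hst, ← hx]; ring)⟩
  have contra : ∀ {s t : ℝ}, 0 < s * t → s • m = t • p → False := by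
    intro s t hst hmp
    obtain ⟨c, hc, hc'⟩ := pos (c := 0) hst hmp
    rw [hc', dot_smul_left] at hmv
    nlinarith
  rcases lt_or_gt_of_ne (h.dot_ne_zero hu hp hp0) with hpu | hpu <;>
    rcases lt_or_gt_of_ne (h.dot_ne_zero hu hm hm0) with hmu | hmu
  · exact (contra (mul_pos_of_neg_of_neg hpu hmu) (h.parallel_of_neg hu hp hm hpu hmu)).elim
  · have := main hm0 hp0
      (pos (c := 0) (mul_pos hmu hpu') (h.parallel_of_pos hu hm hp' hmu hpu'))
      (pos (c := 0) (mul_pos_of_neg_of_neg hpu hmu') (h.parallel_of_neg hu hp hm' hpu hmu'))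
    filter_upwards [this] with y hy hyF
    obtain ⟨t, ht, h3⟩ := hy hyF
    exact ⟨t, ht, h3.symm⟩
  · exact main hp0 hm0
      (pos (c := 0) (mul_pos hpu hpu') (h.parallel_of_pos hu hp hp' hpu hpu'))
      (pos (c := 0) (mul_pos_of_neg_of_neg hmu hmu') (h.parallel_of_neg hu hm hm' hmu hmu'))
  · exact (contra (mul_pos hpu hmu) (h.parallel_of_pos hu hp hm hpu hmu)).elim

end Avoiding

theorem Strand.exists_dirs (hK : Strand F U V r v K) (h : Avoiding F U V r) (hA : A ∈ K) :
    ∃ p ∈ openCone v, ∃ m ∈ openCone (-v), Dir F A p ∧ Dir F A m := by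
  obtain ⟨ε, hε, p, hp, m, hm, hpF, hmF, -⟩ := h.exists_branches_along (hK.sub hA)
  exact ⟨p, hp, m, hm, hpF, hmF⟩

/-- The translate of `K` by `x`. -/
def shift (x : ℂ) (K : Set ℂ) : Set ℂ := {Y | Y - x ∈ K}

theorem IsPiece.dir_shift (hK : IsPiece F K) (hx : ∀ Y ∈ K, Y + x ∈ F) (hA : A ∈ K)
    (hd : Dir F A d) : Dir F (A + x) d := by
  intro t ht
  rw [add_right_comm]
  exact hx _ (hK.add_smul_mem hA hd ht)

theorem Strand.isPiece_shift (hK : Strand F U V r v K) (h : Avoiding F U V r)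
    (hx : ∀ Y ∈ K, Y + x ∈ F) : IsPiece F (shift x K) := by
  refine ⟨fun Y hY => by simpa using hx _ hY, ?_, hK.closed.preimage (by fun_prop), ?_⟩
  · convert hK.preconnected.image (fun Y => Y + x) (by fun_prop) using 1
    ext Y
    simp [shift, sub_eq_add_neg]
  · intro B hB
    have hB' : B - x ∈ K := hB
    obtain ⟨p, hp, m, hm, hpF, hmF⟩ := hK.exists_dirs h hB'
    have hmv := dot_pos_of_mem_openCone hm
    rw [dot_neg] at hmv
    have hpx := hK.isPiece.dir_shift hx hB' hpF
    have hmx := hK.isPiece.dir_shift hx hB' hmF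
    rw [sub_add_cancel] at hpx hmx
    filter_upwards [h.eventually_mem_of_dirs hpx hmx (dot_pos_of_mem_openCone hp)
      (by linarith : dot m v < 0)] with y hy hyF
    obtain ⟨t, ht, rfl | rfl⟩ := hy hyF
    · have := hK.isPiece.add_smul_mem hB' hpF ht
      change _ - x ∈ K
      rwa [add_sub_right_comm]
    · have := hK.isPiece.add_smul_mem hB' hmF ht
      change _ - x ∈ K
      rwa [add_sub_right_comm]

/-- Translation by `x` maps `K` onto itself. -/
def IsPeriod (x : ℂ) (K : Set ℂ) : Prop := ∀ Y, Y + x ∈ K ↔ Y ∈ K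

theorem IsPeriod.add (hx : IsPeriod x K) (hy : IsPeriod y K) : IsPeriod (x + y) K := fun Y => by
  rw [← add_assoc, hy, hx]

theorem IsPeriod.neg (hx : IsPeriod x K) : IsPeriod (-x) K := fun Y => by
  rw [← hx, neg_add_cancel_right]

theorem isPeriod_zero : IsPeriod 0 K := fun Y => by rw [add_zero]

theorem IsPeriod.zsmul (hx : IsPeriod x K) (n : ℤ) : IsPeriod (n • x) K := by
  induction n with
  | zero => simpa using isPeriod_zero
  | succ n ih => rw [add_smul, one_smul]; exact ih.add hx
  | pred n ih => rw [sub_smul, one_smul, sub_eq_add_neg]; exact ih.add hx.neg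

theorem Strand.isPeriod_sub (hK : Strand F U V r v K) (h : Avoiding F U V r)
    (hx : ∀ Y ∈ K, Y + x ∈ F) (hy : ∀ Y ∈ K, Y + y ∈ F) (hA : A ∈ K) (hB : B ∈ K)
    (hAB : A + x = B + y) : IsPeriod (x - y) K := by
  have h1 : shift x K = shift y K := (hK.isPiece_shift h hx).eq (hK.isPiece_shift h hy) (x := A + x)
    (by simpa [shift] using hA) (by simpa [hAB, shift] using hB)
  intro Y
  have h2 : Y + x ∈ shift x K ↔ Y + x ∈ shift y K := by rw [h1]
  simpa [shift, add_sub_assoc] using h2.symm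

theorem Strand.isPeriod (hK : Strand F U V r v K) (h : Avoiding F U V r)
    (hx : ∀ Y ∈ K, Y + x ∈ F) (hA : A ∈ K) (hB : A + x ∈ K) : IsPeriod x K := by
  have := hK.isPeriod_sub h hx (y := 0) (fun Y hY => by simpa using hK.isPiece.sub hY) hA hB
    (by simp)
  simpa using this

theorem Strand.exists_at_distance (hK : Strand F U V r v K) (h : Avoiding F U V r) (hA : A ∈ K)
    {q : ℝ} (hu : ‖u‖ < q) : ∃ Y ∈ K, Y - A ∈ cone v ∧ ‖Y - A + u‖ = q := by
  have hv0 := h.ne_zero_of_along (hK.sub hA)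
  have hclc : IsClosed {Y | Y ∈ K ∧ Y - A ∈ cone v} :=
    hK.closed.inter ((isClosed_cone v).preimage (by fun_prop))
  have hfar : ∃ Y ∈ K, Y - A ∈ cone v ∧ q ≤ ‖Y - A + u‖ := by
    by_contra! hnear
    have hcpt : IsCompact {Y | Y ∈ K ∧ Y - A ∈ cone v} := by
      refine (isCompact_closedBall (A - u) q).of_isClosed_subset hclc ?_
      rintro Y ⟨hY, hYA⟩
      rw [mem_closedBall, dist_eq_norm]
      have := (hnear Y hY hYA).le
      rwa [sub_add] at this
    obtain ⟨Y, ⟨hY, hYA⟩, hmax⟩ := hcpt.exists_isMaxOn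
      ⟨A, hA, by rw [sub_self]; exact zero_mem_cone v⟩ (continuous_dot_left v).continuousOn
    obtain ⟨p, hp, m, hm, hpF, hmF⟩ := hK.exists_dirs h hY
    have h1 : Y + p ∈ K := by simpa using hK.isPiece.add_smul_mem hY hpF (t := 1) (by simp)
    have h2 : Y + p - A ∈ cone v := by
      rw [add_sub_right_comm]
      exact cone_add hYA (openCone_subset_cone v hp)
    have h3 : dot (Y + p) v ≤ dot Y v := hmax ⟨h1, h2⟩
    rw [dot_add_left] at h3
    linarith [dot_pos_of_mem_openCone hp]
  obtain ⟨Y₀, hY₀, hY₀A, hY₀q⟩ := hfar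
  have hcn : Continuous fun Y => ‖Y - A + u‖ := by fun_prop
  have hpc := isPreconnected_closed_iff.1 hK.preconnected
    ({Y | Y - A ∈ cone v} ∩ {Y | q ≤ ‖Y - A + u‖})
    ({Y | A - Y ∈ cone v} ∪ ({Y | Y - A ∈ cone v} ∩ {Y | ‖Y - A + u‖ ≤ q}))
    (((isClosed_cone v).preimage (by fun_prop)).inter (isClosed_le continuous_const hcn))
    (((isClosed_cone v).preimage (by fun_prop)).union
      (((isClosed_cone v).preimage (by fun_prop)).inter (isClosed_le hcn continuous_const)))
    ?_ ⟨Y₀, hY₀, hY₀A, hY₀q⟩ ⟨A, hA, Or.inl (by simpa using zero_mem_cone v)⟩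
  · obtain ⟨Y, hY, ⟨h1, h2⟩, h3 | ⟨-, h3⟩⟩ := hpc
    · have h3 : A - Y ∈ cone v := h3
      have h2 : q ≤ ‖Y - A + u‖ := h2
      by_cases hYA : Y - A = 0
      · rw [hYA, zero_add] at h2
        linarith
      · have h4 := dot_pos_of_mem_cone h1 hYA hv0
        have h5 := dot_nonneg_of_mem_cone h3
        rw [← neg_sub, dot_neg_left] at h5
        linarith
    · exact ⟨Y, hY, h1, le_antisymm h3 h2⟩
  · intro Y hY
    rcases hK.chain A hA Y hY with hc | hc
    · rcases le_total q ‖Y - A + u‖ with hq | hq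
      · exact Or.inl ⟨hc, hq⟩
      · exact Or.inr (Or.inr ⟨hc, hq⟩)
    · exact Or.inr (Or.inl hc)

theorem dot_pos_of_mem_openCone_of_mem_cone (hd : d ∈ openCone v) (hw : w ∈ cone v) (hw0 : w ≠ 0) :
    0 < dot d w := by
  have hv0 : v ≠ 0 := by rintro rfl; simpa [dot] using hd.1
  have key : 3 * ‖v‖ ^ 2 * dot d w =
      4 * (dot d (om * v) * dot w (om * v) + dot d ((1 - om) * v) * dot w ((1 - om) * v)) +
      2 * (dot d (om * v) * dot w ((1 - om) * v) + dot d ((1 - om) * v) * dot w (om * v)) := by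
    rw [← dot_self]
    simp [dot, om]
    linear_combination -(d.im * v.re - d.re * v.im) * (w.im * v.re - w.re * v.im) * sqrt_three_sq
  have hwv := dot_pos_of_mem_cone hw hw0 hv0
  rw [← dot_om_add] at hwv
  obtain ⟨h1, h2⟩ := hd
  obtain ⟨h3, h4⟩ := hw
  have : 0 < 3 * ‖v‖ ^ 2 * dot d w := by
    rw [key]
    rcases h3.eq_or_lt with h3 | h3
    · have h4 : 0 < dot w ((1 - om) * v) := by linarith
      rw [← h3]
      have := mul_pos h2 h4
      have := mul_pos h1 h4
      linarith
    · have := mul_pos h1 h3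
      have := mul_pos h2 h3
      have := mul_nonneg h1.le h4
      have := mul_nonneg h2.le h4
      linarith
  exact pos_of_mul_pos_right this (by positivity)

end PlaneColoring

namespace PlaneColoring

open Set Metric

variable {F U V K : Set ℂ} {A c v w x p m : ℂ} {r : ℝ}

theorem one_lt_sqrt_three : (1 : ℝ) < √3 := by
  rw [Real.lt_sqrt] <;> norm_num

theorem abs_im_le_of_mul_mem_cone (h : c * w ∈ cone w) (hw : w ≠ 0) : |c.im| ≤ c.re := by
  have hn : 0 < dot w w := dot_self_pos hw
  have e1 : dot (c * w) (om * w) = (c.re + √3 * c.im) / 2 * dot w w := by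
    simp [dot, om]; ring
  have e2 : dot (c * w) ((1 - om) * w) = (c.re - √3 * c.im) / 2 * dot w w := by
    simp [dot, om]; ring
  obtain ⟨h1, h2⟩ := h
  rw [e1] at h1
  rw [e2] at h2
  have h1 := nonneg_of_mul_nonneg_left h1 hn
  have h2 := nonneg_of_mul_nonneg_left h2 hn
  have := one_lt_sqrt_three
  rw [abs_le]
  constructor <;> nlinarith

theorem IsConeChain.abs_im_le (h : IsConeChain w K) (hw : w ≠ 0) (hA : A ∈ K)
    (hB : A + c * w ∈ K) : |c.im| ≤ |c.re| := by
  rcases h A hA _ hB with h | h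
  · rw [add_sub_cancel_left] at h
    exact (abs_im_le_of_mul_mem_cone h hw).trans (le_abs_self _)
  · rw [sub_add_cancel_left, ← neg_mul] at h
    have := abs_im_le_of_mul_mem_cone h hw
    rw [Complex.neg_im, Complex.neg_re, abs_neg] at this
    exact this.trans (neg_le_abs _)

theorem abs_om : |om.re| < |om.im| := by
  have := one_lt_sqrt_three
  simp only [om]
  rw [abs_of_pos, abs_of_pos] <;> linarith

theorem abs_one_sub_om : |(1 - om).re| < |(1 - om).im| := by
  have := one_lt_sqrt_three
  simp only [om, Complex.sub_re, Complex.sub_im, Complex.one_re, Complex.one_im]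
  rw [abs_of_pos, abs_of_neg] <;> linarith

theorem IsPeriod.exists_real (hK : IsConeChain w K) (hw0 : w ≠ 0) (hA : A ∈ K)
    (hw : IsPeriod w K) (hx : IsPeriod x K) : ∃ t : ℝ, x = t * w := by
  obtain ⟨c, rfl⟩ : ∃ c, x = c * w := ⟨x / w, (div_mul_cancel₀ x hw0).symm⟩
  have hn : ∀ n : ℕ, n * |c.im| ≤ 1 := by
    intro n
    have h1 := (((hx.zsmul n).add (hw.zsmul (-⌊n * c.re⌋))) A).2 hA
    have h2 := hK.abs_im_le (c := n * c - ⌊n * c.re⌋) hw0 hA (by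
      convert h1 using 2
      simp only [zsmul_eq_mul]
      push_cast
      ring)
    simp only [Complex.sub_im, Complex.sub_re, Complex.mul_im, Complex.mul_re, Complex.natCast_re,
      Complex.natCast_im, Complex.intCast_re, Complex.intCast_im, zero_mul, add_zero,
      sub_zero] at h2
    rw [abs_mul, Nat.abs_cast] at h2
    refine h2.trans ?_
    rw [abs_of_nonneg (by linarith [Int.floor_le ((n : ℝ) * c.re)])]
    linarith [Int.lt_floor_add_one ((n : ℝ) * c.re)]
  have him : c.im = 0 := by
    by_contra h0
    obtain ⟨n, hn'⟩ := exists_nat_gt (1 / |c.im|)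
    rw [div_lt_iff₀ (abs_pos.2 h0)] at hn'
    exact (hn n).not_gt hn'
  exact ⟨c.re, by congr 1; apply Complex.ext <;> simp [him]⟩

theorem Avoiding.mem_switch_of_openCone (h : Avoiding F U V r) (hp : p ∈ openCone v)
    (hm : m ∈ openCone (-v)) (hpF : Dir F A p) (hmF : Dir F A m)
    (hw : ∀ e ∈ openCone v, 0 < dot e w) (hwr : ‖w‖ = r) (hF : A + w ∈ F) :
    w ∈ switch U V r A := by
  have h1 := hw _ (mem_openCone_neg.1 hm)
  rw [dot_neg_left] at h1
  exact h.mem_switch_of_dirs hpF hmF (hw p hp) (by linarith) hwr hF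

namespace Avoiding

theorem exists_strand_of_mem (h : Avoiding F U V r) (hA : A ∈ F) :
    ∃ v K, A ∈ K ∧ Strand F U V r v K := by
  obtain ⟨w, hw⟩ := h.switch_nonempty hA
  rcases h.mem_along_or hA hw with h1 | h1 | h1 <;>
    exact ⟨_, h.exists_strand h1⟩

/-- Every point of `F` lies on a strand having a period in its own direction. -/
theorem exists_period (h : Avoiding F U V r) (hA : A ∈ F) :
    ∃ w K, A ∈ K ∧ Strand F U V r w K ∧ IsPeriod w K := by
  obtain ⟨v, K, hAK, hK⟩ := h.exists_strand_of_mem hA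
  obtain ⟨Y, hY, hYA, hYr⟩ := hK.exists_at_distance h hAK (u := 0) (by simpa using h.pos)
  rw [add_zero] at hYr
  obtain ⟨w, rfl⟩ : ∃ w, Y = A + w := ⟨Y - A, by ring⟩
  rw [add_sub_cancel_left] at hYA hYr
  have hw0 : w ≠ 0 := by
    rintro rfl
    have := h.pos
    simp_all
  obtain ⟨p, hp, m, hm, hpF, hmF⟩ := hK.exists_dirs h hAK
  have hw := h.mem_switch_of_openCone hp hm hpF hmF
    (fun e he => dot_pos_of_mem_openCone_of_mem_cone he hYA hw0) hYr (hK.isPiece.sub hY)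
  have key : ∀ {u : ℂ}, A ∈ along F U V r u → ∃ L, A ∈ L ∧ Strand F U V r u L ∧ A + w ∈ L := by
    intro u hu
    obtain ⟨L, hAL, hL⟩ := h.exists_strand hu
    rw [hK.isPiece.eq hL.isPiece hAK hAL] at hY
    exact ⟨L, hAL, hL, hY⟩
  rcases h.mem_along_or hA hw with h1 | h1 | h1
  · obtain ⟨L, hAL, hL, hwL⟩ := key h1
    exact ⟨w, L, hAL, hL, hL.isPeriod h (fun Y hY => h.mem_of_switch (hL.sub hY).1) hAL hwL⟩
  · obtain ⟨L, hAL, hL, hwL⟩ := key h1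
    refine absurd (hL.chain.abs_im_le (c := 1 - om) (h.ne_zero_of_along h1) hAL ?_)
      abs_one_sub_om.not_ge
    convert hwL using 2
    linear_combination -w * om_mul_om
  · obtain ⟨L, hAL, hL, hwL⟩ := key h1
    refine absurd (hL.chain.abs_im_le (c := -om) (h.ne_zero_of_along h1) hAL ?_)
      (by simpa using abs_om)
    convert hwL using 2
    linear_combination (-w * om - w) * om_mul_om

end Avoiding

end PlaneColoring

namespace PlaneColoring

open Set Metric

variable {F U V K : Set ℂ} {A w : ℂ} {p q r ρ : ℝ}

/-- The ratios `ρ` in `(0, 1)` for which `ρ * w` is a period of `K` and the translate of `K` by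
`ρ * om * w` stays in `F`. -/
def ratios (F K : Set ℂ) (w : ℂ) : Set ℝ :=
  {ρ | 0 < ρ ∧ ρ < 1 ∧ IsPeriod (ρ * w) K ∧ ∀ Y ∈ K, Y + ρ * (om * w) ∈ F}

theorem Strand.norm_eq (hK : Strand F U V r w K) (hA : A ∈ K) : ‖w‖ = r :=
  norm_of_mem_switch (hK.sub hA).1

theorem Strand.exists_ratio_lt (hK : Strand F U V r w K) (h : Avoiding F U V r) (hA : A ∈ K)
    (hw : IsPeriod w K) (hρ : ρ ∈ ratios F K w) : ∃ ρ' ∈ ratios F K w, ρ' < ρ := by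
  obtain ⟨hρ0, hρ1, hρw, hρF⟩ := hρ
  have hwr := hK.norm_eq hA
  have hw0 := h.ne_zero_of_along (hK.sub hA)
  have hr := h.pos
  obtain ⟨Y, hY, hYA, hYr⟩ := hK.exists_at_distance h hA (u := ρ * (om * w)) (q := r) (by
    rw [norm_mul, norm_om_mul, hwr, Complex.norm_of_nonneg hρ0.le]
    nlinarith)
  obtain ⟨x, rfl⟩ : ∃ x, Y = A + x := ⟨Y - A, by ring⟩
  rw [add_sub_cancel_left] at hYA hYr
  have hzF : A + (x + ρ * (om * w)) ∈ F := by
    rw [← add_assoc]; exact hρF _ hY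
  have hdot : ∀ e, dot e (ρ * (om * w)) = ρ * dot e (om * w) := by
    intro e; simp [dot]; ring
  obtain ⟨p, hp, m, hm, hpF, hmF⟩ := hK.exists_dirs h hA
  have hz := h.mem_switch_of_openCone hp hm hpF hmF (w := x + ρ * (om * w)) (fun e he => by
    rw [dot_add, hdot]
    have h1 := mul_pos hρ0 he.1
    by_cases hx0 : x = 0
    · simpa [hx0, dot] using h1
    · linarith [dot_pos_of_mem_openCone_of_mem_cone he hYA hx0]) hYr hzF
  have hsw : ∀ B ∈ K, x + ρ * (om * w) ∈ switch U V r B := by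
    intro B hB
    rw [h.switch_eq_of_preconnected hK.preconnected hK.isPiece.sub hA hB]
    exact hz
  have hx : IsPeriod x K := by
    have := hK.isPeriod_sub h (fun B hB => h.mem_of_switch (hsw B hB)) hρF hA hY (by ring)
    simpa using this
  obtain ⟨τ, rfl⟩ := IsPeriod.exists_real hK.chain hw0 hA hw hx
  have hτ0 : 0 ≤ τ := by
    have h1 := dot_nonneg_of_mem_cone hYA
    have h2 : dot (τ * w) w = τ * dot w w := by simp [dot]; ring
    rw [h2] at h1
    exact nonneg_of_mul_nonneg_left h1 (dot_self_pos hw0)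
  have hquad : τ ^ 2 + τ * ρ + ρ ^ 2 = 1 := by
    have h1 : dot (τ * w + ρ * (om * w)) (τ * w + ρ * (om * w)) = r ^ 2 := by rw [dot_self, hYr]
    have h2 : dot w w = r ^ 2 := by rw [dot_self, hwr]
    have h3 : dot (τ * w + ρ * (om * w)) (τ * w + ρ * (om * w)) =
        (τ ^ 2 + τ * ρ + ρ ^ 2) * dot w w := by
      simp [dot, om]
      linear_combination ρ ^ 2 * (w.re ^ 2 + w.im ^ 2) / 4 * sqrt_three_sq
    rw [h1, h2] at h3
    have : r ^ 2 ≠ 0 := by positivity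
    exact (mul_right_cancel₀ this (by linarith : 1 * r ^ 2 = _)).symm
  have hτ : 0 < τ := by
    rcases hτ0.eq_or_lt with h0 | h0
    · rw [← h0] at hquad; nlinarith
    · exact h0
  have hτ1 : τ < 1 := by nlinarith
  have hsum : 1 < τ + ρ := by nlinarith
  have hfar : ∀ B ∈ K, B + (τ + ρ) * (om * w) ∈ F := by
    intro B hB
    have h1 := h.mem_of_switch (h.om_mul_mem_switch (hK.isPiece.sub ((hρw B).2 hB))
      (hsw _ ((hρw B).2 hB)))
    convert h1 using 1
    linear_combination -ρ * w * om_mul_om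
  refine ⟨τ + ρ - 1, ⟨by linarith, by linarith, ?_, ?_⟩, by linarith⟩
  · convert (hx.add hρw).add hw.neg using 1
    push_cast
    ring
  · intro B hB
    obtain ⟨p, hp, m, hm, hpF, hmF⟩ := hK.exists_dirs h hB
    have hBF := hfar B hB
    have h1 := h.mem_switch_of_openCone hp hm (hK.isPiece.dir_shift hfar hB hpF)
      (hK.isPiece.dir_shift hfar hB hmF) (fun e he => dot_pos_of_mem_openCone he) hwr (by
        rw [add_right_comm]
        exact hfar _ ((hw B).2 hB))
    have h2 := h.mem_of_switch (h.neg_mem_switch hBF (h.om_mul_mem_switch hBF h1))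
    convert h2 using 1
    push_cast
    ring

theorem isClosed_setOf_add_mem {C : Set ℂ} (hC : IsClosed C) (Y x : ℂ) :
    IsClosed {ρ : ℝ | Y + ρ * x ∈ C} :=
  hC.preimage (by fun_prop)

theorem Strand.ratios_eq_empty (hK : Strand F U V r w K) (h : Avoiding F U V r) (hA : A ∈ K)
    (hw : IsPeriod w K) : ratios F K w = ∅ := by
  by_contra hne
  have hw0 := h.ne_zero_of_along (hK.sub hA)
  have hne : (ratios F K w).Nonempty := nonempty_iff_ne_empty.2 hne
  have hbd : BddBelow (ratios F K w) := ⟨0, fun ρ hρ => hρ.1.le⟩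
  have hcl := csInf_mem_closure hne hbd
  set σ := sInf (ratios F K w) with hσ
  have hσ0 : 0 ≤ σ := le_csInf hne fun ρ hρ => hρ.1.le
  rcases hσ0.eq_or_lt with h0 | h0
  · have hev : ∀ᶠ ρ : ℝ in nhds 0, A + ρ * (om * w) ∈ F → A + ρ * (om * w) ∈ K := by
      have hc : Filter.Tendsto (fun ρ : ℝ => A + ρ * (om * w)) (nhds 0) (nhds A) := by
        have : Continuous fun ρ : ℝ => A + ρ * (om * w) := by fun_prop
        simpa using this.tendsto 0
      exact hc.eventually (hK.isolated A hA)
    rw [← h0] at hcl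
    obtain ⟨ρ, hρK, hρ⟩ := (mem_closure_iff_frequently.1 hcl).and_eventually hev |>.exists
    have h1 := hK.chain.abs_im_le (c := ρ * om) hw0 hA (by
      rw [mul_assoc]; exact hρ (hρK.2.2.2 A hA))
    rw [Complex.re_ofReal_mul, Complex.im_ofReal_mul, abs_mul, abs_mul] at h1
    exact abs_om.not_ge (le_of_mul_le_mul_left h1 (abs_pos.2 hρK.1.ne'))
  · have hσ1 : σ < 1 := by
      obtain ⟨ρ, hρ⟩ := hne
      exact (csInf_le hbd hρ).trans_lt hρ.2.1
    have hσK : σ ∈ ratios F K w := by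
      refine ⟨h0, hσ1, ?_, fun Y hY => ?_⟩
      · have hadd : ∀ Y ∈ K, Y + σ * w ∈ K := fun Y hY =>
          closure_minimal (fun ρ hρ => (hρ.2.2.1 Y).2 hY) (isClosed_setOf_add_mem hK.closed Y w) hcl
        exact hK.isPeriod h (fun Y hY => hK.isPiece.sub (hadd Y hY)) hA (hadd A hA)
      · exact closure_minimal (fun ρ hρ => hρ.2.2.2 Y hY)
          (isClosed_setOf_add_mem h.col.isClosed Y _) hcl
    obtain ⟨ρ, hρ, hlt⟩ := hK.exists_ratio_lt h hA hw hσK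
    exact (csInf_le hbd hρ).not_gt hlt

theorem Avoiding.radius_not_lt (hp : Avoiding F U V p) (hq : Avoiding F U V q) (hA : A ∈ F) :
    ¬ p < q := by
  intro hpq
  obtain ⟨w, K, hAK, hK, hw⟩ := hq.exists_period hA
  obtain ⟨w', K', hAK', hK', hw'⟩ := hp.exists_period hA
  have hw0 := hq.ne_zero_of_along (hK.sub hAK)
  obtain rfl := hK.isPiece.eq hK'.isPiece hAK hAK'
  obtain ⟨t, rfl⟩ := IsPeriod.exists_real hK.chain hw0 hAK hw hw'
  have hn := hK'.norm_eq hAK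
  rw [norm_mul, hK.norm_eq hAK, Complex.norm_real, Real.norm_eq_abs] at hn
  have hq0 := hq.pos
  have hp0 := hp.pos
  have ht1 : |t| < 1 := by by_contra! h; nlinarith
  have ht0 : t ≠ 0 := by rintro rfl; simp at hn; linarith
  have hsw : ∀ Y ∈ K, Y + t * (om * w) ∈ F ∧ Y + -(t * (om * w)) ∈ F := by
    intro Y hY
    have hYF := hK.isPiece.sub hY
    have h1 := hp.om_mul_mem_switch hYF (hK'.sub hY).1
    rw [mul_left_comm] at h1
    exact ⟨hp.mem_of_switch h1, hp.mem_of_switch (hp.neg_mem_switch hYF h1)⟩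
  have : |t| ∈ ratios F K w := by
    refine ⟨abs_pos.2 ht0, ht1, ?_⟩
    rcases abs_choice t with h | h <;> rw [h]
    · exact ⟨hw', fun Y hY => (hsw Y hY).1⟩
    · push_cast
      simp only [neg_mul]
      exact ⟨hw'.neg, fun Y hY => (hsw Y hY).2⟩
  rw [hK.ratios_eq_empty hq hAK hw] at this
  exact this

theorem Avoiding.nonempty (h : Avoiding F U V r) : F.Nonempty := by
  by_contra hF
  rw [not_nonempty_iff_eq_empty] at hF
  have hcov : univ ⊆ U ∪ V := by rw [← h.col.compl_eq, hF, compl_empty]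
  have hr : ‖(r : ℂ)‖ = r := by rw [Complex.norm_of_nonneg h.pos.le]
  rcases isPreconnected_iff_subset_of_disjoint.1 isPreconnected_univ U V h.col.isOpen_left
    h.col.isOpen_right hcov (by rw [h.col.disj.inter_eq, inter_empty]) with hU | hV
  · exact h.left 0 r hr (hU trivial) (hU trivial) (hU trivial)
  · exact h.right 0 r hr (hV trivial) (hV trivial) (hV trivial)

/-- A polygonal coloring avoids monochromatic equilateral triangles of at most one size. -/
theorem Avoiding.radius_unique (hp : Avoiding F U V p) (hq : Avoiding F U V q) : p = q := by
  obtain ⟨A, hA⟩ := hp.nonempty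
  exact le_antisymm (not_lt.1 (hq.radius_not_lt hp hA)) (not_lt.1 (hp.radius_not_lt hq hA))

end PlaneColoring

namespace PlaneColoring

open Set Metric

variable {F U V : Set ℂ} {a b c : ℝ}

theorem IsTwoColoring.dense_compl (h : IsTwoColoring F U V) : Dense Fᶜ := by
  intro x
  rw [h.compl_eq, closure_union]
  by_cases hx : x ∈ F
  · exact Or.inl (h.sub_left hx)
  · have : x ∈ U ∪ V := h.compl_eq ▸ hx
    exact this.imp (fun h => subset_closure h) fun h => subset_closure h

theorem IsTwoColoring.dense_add_notMem (h : IsTwoColoring F U V) (z : ℂ) :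
    Dense {x | x + z ∉ F} :=
  h.dense_compl.preimage (Homeomorph.addRight z).isOpenMap

theorem IsTwoColoring.isOpen_add_notMem (h : IsTwoColoring F U V) (z : ℂ) :
    IsOpen {x | x + z ∉ F} :=
  h.isClosed.isOpen_compl.preimage (f := fun x => x + z) (by fun_prop)

theorem IsTwoColoring.exists_notMem (h : IsTwoColoring F U V) (s : Finset ℂ) {O : Set ℂ}
    (hO : IsOpen O) (hne : O.Nonempty) : ∃ x ∈ O, ∀ z ∈ s, x + z ∉ F := by
  classical
  induction s using Finset.induction_on generalizing O with
  | empty => obtain ⟨x, hx⟩ := hne; exact ⟨x, hx, by simp⟩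
  | insert z s _ ih =>
    obtain ⟨x, hx, hxs⟩ := ih (hO.inter (h.isOpen_add_notMem z))
      ((h.dense_add_notMem z).inter_open_nonempty O hO hne)
    refine ⟨x, hx.1, fun y hy => ?_⟩
    rcases Finset.mem_insert.1 hy with rfl | hy
    · exact hx.2
    · exact hxs y hy

/-- The set `U` contains no triangle with sides `a`, `b`, `c`. -/
def NoTriangle (U : Set ℂ) (a b c : ℝ) : Prop :=
  ∀ X Y Z : ℂ, ‖Y - X‖ = a → ‖Z - Y‖ = b → ‖X - Z‖ = c → X ∈ U → Y ∈ U → Z ∉ U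

theorem NoTriangle.rotate (h : NoTriangle U a b c) : NoTriangle U b c a :=
  fun X Y Z hXY hYZ hZX hX hY hZ => h Z X Y hZX hXY hYZ hZ hX hY

theorem exists_apex (ha : 0 < a) (hb : 0 < b) (hc : 0 < c) (h₁ : a ≤ b + c) (h₂ : b ≤ a + c)
    (h₃ : c ≤ a + b) {u : ℂ} (hu : ‖u‖ = a) : ∃ β, ‖β - u‖ = b ∧ ‖β‖ = c := by
  set x : ℝ := (a ^ 2 + c ^ 2 - b ^ 2) / (2 * a ^ 2) with hx
  have hx' : 2 * a ^ 2 * x = a ^ 2 + c ^ 2 - b ^ 2 := by rw [hx]; field_simp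
  have hnn : 0 ≤ c ^ 2 / a ^ 2 - x ^ 2 := by
    have h1 : 0 ≤ ((a + c) ^ 2 - b ^ 2) * (b ^ 2 - (a - c) ^ 2) := by
      apply mul_nonneg <;> nlinarith
    have h2 : c ^ 2 / a ^ 2 - x ^ 2 =
        ((a + c) ^ 2 - b ^ 2) * (b ^ 2 - (a - c) ^ 2) / (2 * a ^ 2) ^ 2 := by
      rw [hx]; field_simp; ring
    rw [h2]; positivity
  have hy := Real.mul_self_sqrt hnn
  set y := √(c ^ 2 / a ^ 2 - x ^ 2)
  have hsum : a ^ 2 * (x ^ 2 + y ^ 2) = c ^ 2 := by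
    rw [pow_two y, hy]; field_simp; ring
  have huu : u.re * u.re + u.im * u.im = a ^ 2 := by
    rw [← hu, Complex.sq_norm, Complex.normSq_apply]
  refine ⟨⟨x, y⟩ * u, ?_, ?_⟩
  · rw [← sq_eq_sq₀ (norm_nonneg _) hb.le, Complex.sq_norm, Complex.normSq_apply]
    simp
    linear_combination (x ^ 2 + y ^ 2 - 2 * x + 1) * huu + hsum - hx'
  · rw [← sq_eq_sq₀ (norm_nonneg _) hc.le, Complex.sq_norm, Complex.normSq_apply]
    simp
    linear_combination (x ^ 2 + y ^ 2) * huu + hsum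

theorem IsTwoColoring.noEquilateral (h : IsTwoColoring F U V) (hU : NoTriangle U a b c)
    (hV : NoTriangle V a b c) (ha : 0 < a) (hb : 0 < b) (hc : 0 < c) (h₁ : a ≤ b + c)
    (h₂ : b ≤ a + c) (h₃ : c ≤ a + b) : NoEquilateral U a := by
  classical
  intro X u hu hX hXu hXou
  obtain ⟨β, hβu, hβ⟩ := exists_apex ha hb hc h₁ h₂ h₃ hu
  have tri : ∀ {W : Set ℂ}, NoTriangle W a b c → ∀ ε p q s : ℂ, ‖ε‖ = 1 → q = p + ε * u →
      s = p + ε * β → p ∈ W → q ∈ W → s ∉ W := by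
    rintro W hW ε p q s hε rfl rfl
    refine hW _ _ _ ?_ ?_ ?_
    · rw [add_sub_cancel_left, norm_mul, hε, one_mul, hu]
    · rw [add_sub_add_left_eq_sub, ← mul_sub, norm_mul, hε, one_mul, hβu]
    · rw [sub_add_cancel_left, norm_neg, norm_mul, hε, one_mul, hβ]
  have hO : IsOpen (U ∩ ({x | x + u ∈ U} ∩ {x | x + om * u ∈ U})) :=
    h.isOpen_left.inter ((h.isOpen_left.preimage (by fun_prop)).inter
      (h.isOpen_left.preimage (by fun_prop)))
  obtain ⟨O, ⟨hOU, hu', hou⟩, hs⟩ := h.exists_notMem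
    {om * u - β, om * u - om * β, u - β, u + (om - 1) * β, u + om * u - β} hO ⟨X, hX, hXu, hXou⟩
  simp only [Finset.mem_insert, Finset.mem_singleton, forall_eq_or_imp, forall_eq] at hs
  obtain ⟨h1, h2, h3, h4, h5⟩ := hs
  have hu' : O + u ∈ U := hu'
  have hou : O + om * u ∈ U := hou
  have n1 : ‖om‖ = 1 := norm_om
  have n2 : ‖1 - om‖ = 1 := by simpa using norm_one_sub_om_mul 1
  have n3 : ‖om - 1‖ = 1 := by rw [norm_sub_rev, n2]
  have toV : ∀ {z}, z ∉ F → z ∉ U → z ∈ V := fun hz hzU => (h.mem_or hz).resolve_left hzU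
  have toU : ∀ {z}, z ∉ F → z ∉ V → z ∈ U := fun hz hzV => (h.mem_or hz).resolve_right hzV
  have v2 := toV h2 (tri hU (-om) _ _ _ (by simpa) (by ring) (by ring) hou hOU)
  have v4 := toV h4 (tri hU (om - 1) _ _ _ n3 (by ring) (by ring) hu' hou)
  have v3 := toV h3 (tri hU (-1) _ _ _ (by simp) (by ring) (by ring) hu' hOU)
  have u1 := toU h1 fun v1 => tri hV (1 - om) _ _ _ n2 (by ring) (by ring) v1 v3 v2
  have u5 := toU h5 fun v5 => tri hV om _ _ _ n1 (by ring) (by ring) v3 v5 v4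
  exact tri hU 1 _ _ _ (by simp) (by ring) (by ring) u1 u5 hou

theorem IsTwoColoring.avoiding (h : IsTwoColoring F U V) (hU : NoTriangle U a b c)
    (hV : NoTriangle V a b c) (ha : 0 < a) (hb : 0 < b) (hc : 0 < c) (h₁ : a ≤ b + c)
    (h₂ : b ≤ a + c) (h₃ : c ≤ a + b) : Avoiding F U V a :=
  ⟨h, ha, h.noEquilateral hU hV ha hb hc h₁ h₂ h₃,
    h.symm.noEquilateral hV hU ha hb hc h₁ h₂ h₃⟩

/-- A polygonal coloring contains a monochromatic copy of every triangle with at least two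
different sides. -/
theorem IsTwoColoring.sides_eq (h : IsTwoColoring F U V) (hU : NoTriangle U a b c)
    (hV : NoTriangle V a b c) (ha : 0 < a) (hb : 0 < b) (hc : 0 < c) (h₁ : a ≤ b + c)
    (h₂ : b ≤ a + c) (h₃ : c ≤ a + b) : a = b ∧ b = c := by
  have h1 := h.avoiding hU hV ha hb hc h₁ h₂ h₃
  have h2 := h.avoiding hU.rotate hV.rotate hb hc ha (by linarith) (by linarith) (by linarith)
  have h3 := h.avoiding hU.rotate.rotate hV.rotate.rotate hc ha hb (by linarith) (by linarith)
    (by linarith)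
  exact ⟨h1.radius_unique h2, h2.radius_unique h3⟩

end PlaneColoring

namespace PlaneColoring

open Set Metric

/-- The identification of the complex numbers with the Euclidean plane. -/
def toPlane : ℂ ≃ₗᵢ[ℝ] EuclideanSpace ℝ (Fin 2) := Complex.orthonormalBasisOneI.repr

theorem exists_equation {s : Set (EuclideanSpace ℝ (Fin 2))} (hs : IsSeg s) :
    ∃ l : ℂ × ℝ, l.1 ≠ 0 ∧ ∀ x, toPlane x ∈ s → dot l.1 x = l.2 := by
  obtain ⟨-, -, -, l, ⟨⟨P, hP⟩, hl⟩, hsl⟩ := hs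
  obtain ⟨⟨v, hv⟩, hv0, hspan⟩ := finrank_eq_one_iff'.1 hl
  have hv0' : toPlane.symm v ≠ 0 := by
    intro h0
    apply hv0
    rw [EmbeddingLike.map_eq_zero_iff] at h0
    exact Subtype.ext h0
  refine ⟨(Complex.I * toPlane.symm v, dot (Complex.I * toPlane.symm v) (toPlane.symm P)),
    mul_ne_zero Complex.I_ne_zero hv0', fun x hx => ?_⟩
  obtain ⟨c, hc⟩ := hspan ⟨toPlane x -ᵥ P, AffineSubspace.vsub_mem_direction (hsl hx) hP⟩
  have hc : c • v = toPlane x - P := congrArg Subtype.val hc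
  have hx' : x = toPlane.symm P + c • toPlane.symm v := by
    rw [← map_smul, ← map_add, hc, add_sub_cancel, LinearIsometryEquiv.symm_apply_apply]
  rw [hx']
  simp [dot]
  ring

theorem isTwoColoring_of_isPolygonal {B : Set (EuclideanSpace ℝ (Fin 2))}
    {S : Set (Set (EuclideanSpace ℝ (Fin 2)))} (h : IsPolygonal B S) :
    IsTwoColoring (toPlane ⁻¹' frontier B) (toPlane ⁻¹' interior B)
      (toPlane ⁻¹' interior Bᶜ) where
  isOpen_left := isOpen_interior.preimage toPlane.continuous
  isOpen_right := isOpen_interior.preimage toPlane.continuous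
  disj := (disjoint_compl_right.mono interior_subset interior_subset).preimage _
  compl_eq := by
    rw [← preimage_compl, ← preimage_union, compl_frontier_eq_union_interior]
  sub_left := by
    have h1 := toPlane.toHomeomorph.preimage_closure (interior B)
    rw [LinearIsometryEquiv.coe_toHomeomorph] at h1
    rw [← h1]
    exact preimage_mono (frontier_subset_closure.trans
      (closure_minimal h.black_sub isClosed_closure))
  sub_right := by
    have h1 := toPlane.toHomeomorph.preimage_closure (interior Bᶜ)
    rw [LinearIsometryEquiv.coe_toHomeomorph] at h1
    rw [← h1, ← frontier_compl]
    exact preimage_mono (frontier_subset_closure.trans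
      (closure_minimal h.white_sub isClosed_closure))
  lines R := by
    choose! f hf0 hf using fun s (hs : s ∈ S) => exists_equation (h.seg s hs)
    refine ⟨f '' {s ∈ S | (s ∩ closedBall 0 R).Nonempty},
      (h.loc_finite _ isBounded_closedBall).image f, ?_, ?_⟩
    · rintro _ ⟨s, hs, rfl⟩
      exact hf0 s hs.1
    · intro x hx hxR
      have hx : toPlane x ∈ frontier B := hx
      rw [h.boundary] at hx
      obtain ⟨s, hs, hxs⟩ := hx
      exact ⟨f s, ⟨s, ⟨hs, _, hxs, by simpa using hxR⟩, rfl⟩, hf s hs x hxs⟩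

end PlaneColoring

theorem stmt11 (B : Set (EuclideanSpace ℝ (Fin 2))) (S : Set (Set (EuclideanSpace ℝ (Fin 2))))
    (hpoly : IsPolygonal B S) (a b c : ℝ)
    (ha : 0 < a) (hb : 0 < b) (hc : 0 < c)
    (h₁ : a ≤ b + c) (h₂ : b ≤ a + c) (h₃ : c ≤ a + b)
    (hne : ¬(a = b ∧ b = c)) :
    ∃ X Y Z : EuclideanSpace ℝ (Fin 2),
      X ∉ frontier B ∧ Y ∉ frontier B ∧ Z ∉ frontier B ∧
      ((X ∈ B ∧ Y ∈ B ∧ Z ∈ B) ∨ (X ∉ B ∧ Y ∉ B ∧ Z ∉ B)) ∧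
      dist X Y = a ∧ dist Y Z = b ∧ dist Z X = c := by
  open PlaneColoring in
  by_contra hno
  have hcol := isTwoColoring_of_isPolygonal hpoly
  have hdist : ∀ x y : ℂ, dist (toPlane x) (toPlane y) = ‖y - x‖ := fun x y => by
    rw [LinearIsometryEquiv.dist_map, dist_comm, dist_eq_norm]
  refine hne (hcol.sides_eq ?_ ?_ ha hb hc h₁ h₂ h₃)
  · intro X Y Z hXY hYZ hZX hX hY hZ
    exact hno ⟨toPlane X, toPlane Y, toPlane Z, fun hf => hcol.notMem_left hf hX,
      fun hf => hcol.notMem_left hf hY, fun hf => hcol.notMem_left hf hZ,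
      Or.inl ⟨interior_subset hX, interior_subset hY, interior_subset hZ⟩,
      by rw [hdist, hXY], by rw [hdist, hYZ], by rw [hdist, hZX]⟩
  · intro X Y Z hXY hYZ hZX hX hY hZ
    exact hno ⟨toPlane X, toPlane Y, toPlane Z, fun hf => hcol.notMem_right hf hX,
      fun hf => hcol.notMem_right hf hY, fun hf => hcol.notMem_right hf hZ,
      Or.inr ⟨fun h => interior_subset hX h, fun h => interior_subset hY h,
        fun h => interior_subset hZ h⟩,
      by rw [hdist, hXY], by rw [hdist, hYZ], by rw [hdist, hZX]⟩

end
end
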